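/- arXiv:1301.4446 — 2 statements merged into one kernel-verified Lean document; each statement's English description precedes it below -/
import Mathlib

section
/- Let G be a finitely generated Coxeter group (a group admitting a Coxeter presentation on a finite generating set). Then the canonical projection f : Aut(G) → Out(G) splits virtually. -/
section Defs

variable (G : Type*) [Group G]

/-- The subgroup of inner automorphisms of `G`. -/
def Inn : Subgroup (MulAut G) := (MulAut.conj : G →* MulAut G).range

instance Inn.normal : (Inn G).Normal := by
  constructor
  intro n hn φ
  obtain ⟨g, rfl⟩ := hn
  refine ⟨φ g, ?_⟩
  ext x
  simp only [MulAut.conj_apply, MulAut.mul_apply, map_mul, map_inv, MulAut.inv_def,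
    MulEquiv.apply_symm_apply]

/-- The outer automorphism group `Out(G) = Aut(G)/Inn(G)`. -/
def Out := MulAut G ⧸ Inn G

instance : Group (Out G) := inferInstanceAs (Group (MulAut G ⧸ Inn G))

/-- The canonical projection `Aut(G) → Out(G)`. -/
def outProj : MulAut G →* Out G := QuotientGroup.mk' (Inn G)

/-- A surjective homomorphism `f : A → B` splits virtually if it admits a section on some
finite-index subgroup of `B`. -/
def SplitsVirtually {A B : Type*} [Group A] [Group B] (f : A →* B) : Prop :=
  ∃ B' : Subgroup B, B'.FiniteIndex ∧ ∃ s : (↥B') →* A, ∀ x : B', f (s x) = (x : B)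

/-- A group is residually finite if every nontrivial element survives in some finite quotient. -/
def ResiduallyFinite (G : Type*) [Group G] : Prop :=
  ∀ g : G, g ≠ 1 → ∃ (F : Type) (_ : Group F) (_ : Finite F) (φ : G →* F), φ g ≠ 1

/-- A group is residually `p` if every nontrivial element survives in some finite `p`-group
quotient. -/
def ResiduallyP (p : ℕ) (G : Type*) [Group G] : Prop :=
  ∀ g : G, g ≠ 1 →
    ∃ (F : Type) (_ : Group F) (_ : Finite F) (φ : G →* F), IsPGroup p F ∧ φ g ≠ 1

/-- A group is virtually residually `p` if some finite-index subgroup is residually `p`. -/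
def VirtuallyResiduallyP (p : ℕ) (G : Type*) [Group G] : Prop :=
  ∃ K : Subgroup G, K.FiniteIndex ∧ ResiduallyP p ↥K

/-- `Aut_{H̲}(G)`: the subgroup of automorphisms of `G` fixing `H` pointwise. -/
def autFix (H : Subgroup G) : Subgroup (MulAut G) where
  carrier := {φ | ∀ h ∈ H, φ h = h}
  one_mem' := fun _ _ => rfl
  mul_mem' := by
    intro a b ha hb h hh
    show a (b h) = h
    rw [hb h hh, ha h hh]
  inv_mem' := by
    intro a ha h hh
    show a⁻¹ h = h
    calc a⁻¹ h = a⁻¹ (a h) := by rw [ha h hh]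
    _ = h := by rw [MulAut.inv_def]; exact a.symm_apply_apply h

/-- `Aut_H(G)`: the subgroup of automorphisms of `G` mapping `H` onto itself. -/
def autSetwise (H : Subgroup G) : Subgroup (MulAut G) where
  carrier := {φ | ∀ g : G, φ g ∈ H ↔ g ∈ H}
  one_mem' := fun _ => Iff.rfl
  mul_mem' := by
    intro a b ha hb g
    show a (b g) ∈ H ↔ g ∈ H
    rw [ha, hb]
  inv_mem' := by
    intro a ha g
    show a⁻¹ g ∈ H ↔ g ∈ H
    have h1 : a (a⁻¹ g) = g := by rw [MulAut.inv_def]; exact a.apply_symm_apply g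
    have := ha (a⁻¹ g)
    rw [h1] at this
    exact this.symm

theorem mem_autSetwise {H : Subgroup G} {φ : MulAut G} :
    φ ∈ autSetwise G H ↔ ∀ g : G, φ g ∈ H ↔ g ∈ H := Iff.rfl

/-- `H` is an Aut-splitting subgroup of `G` if the restriction of `Aut(G) → Out(G)` to
`Aut_{H̲}(G)` has finite kernel and an image of finite index in `Out(G)`. -/
def IsAutSplitting (H : Subgroup G) : Prop :=
  Finite ((outProj G).comp (autFix G H).subtype).ker ∧
    ((autFix G H).map (outProj G)).FiniteIndex

/-- The conjugate `gKg⁻¹` of a subgroup. -/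
def conjSubgroup (g : G) (K : Subgroup G) : Subgroup G :=
  K.map (MulAut.conj g).toMonoidHom

end Defs

set_option linter.unusedSectionVars false
set_option linter.unusedSimpArgs false

section Geom

open Real

/-- Cartan entries of the geometric representation (`M i j = 0` encodes infinity). -/
noncomputable def cxK {B : Type} (M : CoxeterMatrix B) (i j : B) : ℝ := -2 * cos (π / M i j)

/-- Chebyshev-like sequence `sin (kθ) / sin θ`. -/
noncomputable def cxA (θ : ℝ) : ℕ → ℝ
  | 0 => 0
  | 1 => 1
  | (k+2) => 2 * cos θ * cxA θ (k+1) - cxA θ k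

theorem cxA_sin (θ : ℝ) : ∀ k : ℕ, sin θ * cxA θ k = sin (k * θ)
  | 0 => by simp [cxA]
  | 1 => by simp [cxA]
  | (k+2) => by
    have h1 := cxA_sin θ (k+1)
    have h0 := cxA_sin θ k
    have e1 : ((k + 2 : ℕ) : ℝ) * θ = ((k+1 : ℕ) : ℝ) * θ + θ := by push_cast; ring
    have e0 : (k : ℝ) * θ = ((k+1 : ℕ) : ℝ) * θ - θ := by push_cast; ring
    rw [e0, sin_sub] at h0
    rw [e1, sin_add, cxA, mul_sub, h0]
    linear_combination 2 * cos θ * h1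

theorem cxA_zero : ∀ k : ℕ, cxA 0 k = k
  | 0 => by simp [cxA]
  | 1 => by simp [cxA]
  | (k+2) => by
    rw [cxA, cxA_zero (k+1), cxA_zero k]; push_cast; simp; ring

theorem cx_sin_pos {m : ℕ} (hm : 2 ≤ m) : 0 < sin (π / m) := by
  have : (2:ℝ) ≤ m := by exact_mod_cast hm
  apply sin_pos_of_pos_of_lt_pi
  · have := pi_pos; positivity
  · rw [div_lt_iff₀ (by linarith)]; nlinarith [pi_pos]

theorem cxA_nonneg {m k : ℕ} (hm : m ≠ 1) (hk : m ≠ 0 → k ≤ m) : 0 ≤ cxA (π / m) k := by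
  rcases Nat.eq_zero_or_pos m with rfl | hpos
  · simp [cxA_zero]
  · have h2 : 2 ≤ m := by omega
    have hs := cx_sin_pos h2
    have := cxA_sin (π / m) k
    have hk' : (k:ℝ) ≤ m := by exact_mod_cast hk (by omega)
    have hm' : (0:ℝ) < m := by exact_mod_cast hpos
    have : 0 ≤ sin (k * (π / m)) := by
      apply sin_nonneg_of_nonneg_of_le_pi
      · have := pi_pos; positivity
      · rw [← mul_div_assoc, div_le_iff₀ hm']; nlinarith [pi_pos]
    by_contra hneg
    push Not at hneg
    nlinarith

theorem cxA_two_mul {m : ℕ} (hm : 2 ≤ m) : cxA (π / m) (2 * m) = 0 := by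
  have hs := cx_sin_pos hm
  have := cxA_sin (π / m) (2 * m)
  have hm' : (m:ℝ) ≠ 0 := by have : m ≠ 0 := by omega
                             exact_mod_cast this
  have e : ((2 * m : ℕ) : ℝ) * (π / m) = 2 * π := by push_cast; field_simp
  rw [e, sin_two_pi] at this
  rcases mul_eq_zero.1 this with h | h
  · exact absurd h hs.ne'
  · exact h

theorem cxA_two_mul_succ {m : ℕ} (hm : 2 ≤ m) : cxA (π / m) (2 * m + 1) = 1 := by
  have hs := cx_sin_pos hm
  have := cxA_sin (π / m) (2 * m + 1)
  have hm' : (m:ℝ) ≠ 0 := by have : m ≠ 0 := by omega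
                             exact_mod_cast this
  have e : ((2 * m + 1 : ℕ) : ℝ) * (π / m) = π / m + 2 * π := by push_cast; field_simp; ring
  rw [e, sin_add_two_pi] at this
  exact mul_left_cancel₀ hs.ne' (by rw [this, mul_one])

variable {B : Type} [Fintype B] [DecidableEq B] (M : CoxeterMatrix B)

theorem cxK_symm (i j : B) : cxK M i j = cxK M j i := by
  rw [cxK, cxK, M.symmetric]

theorem cxK_self (i : B) : cxK M i i = 2 := by
  simp [cxK]

/-- The basis vector. -/
noncomputable abbrev cxE (i : B) : B → ℝ := Pi.single i 1

/-- The coroot functional. -/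
noncomputable def cxF (i : B) : (B → ℝ) →ₗ[ℝ] ℝ := ∑ j, cxK M i j • LinearMap.proj j

theorem cxF_apply (i : B) (v : B → ℝ) : cxF M i v = ∑ j, cxK M i j * v j := by
  simp [cxF]

@[simp] theorem cxF_E (i j : B) : cxF M i (cxE j) = cxK M i j := by
  simp [cxF_apply, Pi.single_apply]

/-- Simple reflections. -/
noncomputable def cxS (i : B) : Module.End ℝ (B → ℝ) :=
  LinearMap.id - (cxF M i).smulRight (cxE i)

theorem cxS_apply (i : B) (v : B → ℝ) : cxS M i v = v - cxF M i v • cxE i := by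
  simp [cxS]

theorem cxS_E (i j : B) : cxS M i (cxE j) = cxE j - cxK M i j • cxE i := by
  simp only [cxS_apply, cxF_E]

theorem cxS_E_self (i : B) : cxS M i (cxE i) = - cxE i := by
  rw [cxS_E, cxK_self]; module

theorem cxS_sq (i : B) : cxS M i * cxS M i = 1 := by
  ext1 v
  ext1
  simp [cxS_apply, Module.End.mul_apply, cxK_self]
  ring_nf
  try simp

theorem cx_rot_pow (s t : B) (n : ℕ) :
    ((cxS M s * cxS M t) ^ n) (cxE s) =
      cxA (π / M s t) (2 * n + 1) • cxE s + cxA (π / M s t) (2 * n) • cxE t ∧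
    ((cxS M s * cxS M t) ^ n) (cxE t) =
      (-cxA (π / M s t) (2 * n)) • cxE s +
      (cxA (π / M s t) (2 * n + 1) - 2 * cos (π / M s t) * cxA (π / M s t) (2 * n)) • cxE t := by
  have hs : ∀ v, (cxS M s * cxS M t) v = cxS M s (cxS M t v) := fun v => rfl
  have hk : cxK M s t = -(2 * cos (π / M s t)) := by rw [cxK]; ring
  have hk' : cxK M t s = -(2 * cos (π / M s t)) := by rw [cxK_symm, hk]
  induction n with
  | zero => simp [cxA]
  | succ n ih =>
    have a1 : cxA (π / M s t) (2 * (n + 1)) = 2 * cos (π / M s t) * cxA (π / M s t) (2 * n + 1)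
      - cxA (π / M s t) (2 * n) := rfl
    have a2 : cxA (π / M s t) (2 * (n + 1) + 1) =
      2 * cos (π / M s t) * cxA (π / M s t) (2 * (n + 1))
      - cxA (π / M s t) (2 * n + 1) := rfl
    rw [pow_succ']
    rw [a2, a1]
    generalize cxA (π / M s t) (2 * n) = x at *
    generalize cxA (π / M s t) (2 * n + 1) = y at *
    generalize 2 * cos (π / M s t) = c at *
    constructor
    · rw [Module.End.mul_apply, ih.1, hs]
      simp only [map_add, map_smul, map_sub, cxS_E, cxS_E_self, hk, hk', cxK_self]
      module
    · rw [Module.End.mul_apply, ih.2, hs]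
      simp only [map_add, map_smul, map_sub, cxS_E, cxS_E_self, hk, hk', cxK_self]
      module

theorem cx_fix_pow (s t : B) (v : B → ℝ) (h1 : cxF M s v = 0) (h2 : cxF M t v = 0) (n : ℕ) :
    ((cxS M s * cxS M t) ^ n) v = v := by
  induction n with
  | zero => simp
  | succ n ih =>
    rw [pow_succ, Module.End.mul_apply, Module.End.mul_apply, cxS_apply M t, h2]
    simp [cxS_apply, h1, ih]

theorem cx_liftable : M.IsLiftable (cxS M) := by
  intro s t
  by_cases hst : s = t
  · subst hst; simp [cxS_sq]
  by_cases h0 : M s t = 0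
  · simp [h0]
  have h2 : 2 ≤ M s t := by
    have := M.off_diagonal s t hst
    omega
  have hsin := cx_sin_pos h2
  obtain ⟨r1, r2⟩ := cx_rot_pow M s t (M s t)
  rw [cxA_two_mul h2, cxA_two_mul_succ h2] at r1 r2
  have hk : cxK M s t = -(2 * cos (π / M s t)) := by rw [cxK]; ring
  have hk' : cxK M t s = -(2 * cos (π / M s t)) := by rw [cxK_symm, hk]
  refine LinearMap.ext fun v => ?_
  set C := cos (π / M s t)
  set S := sin (π / M s t)
  have hsc : S ^ 2 + C ^ 2 = 1 := sin_sq_add_cos_sq _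
  have hS : S ≠ 0 := hsin.ne'
  obtain ⟨p, q, hp, hq⟩ : ∃ p q : ℝ, 2 * p - 2 * C * q = cxF M s v ∧
      - 2 * C * p + 2 * q = cxF M t v := by
    refine ⟨(cxF M s v + C * cxF M t v) / (2 * S ^ 2), (C * cxF M s v + cxF M t v) / (2 * S ^ 2),
      ?_, ?_⟩
    · field_simp
      linear_combination - (cxF M s v) * hsc
    · field_simp
      linear_combination - (cxF M t v) * hsc
  have hv : v = (v - p • cxE s - q • cxE t) + p • cxE s + q • cxE t := by module
  rw [hv, map_add, map_add, map_smul, map_smul, r1, r2, cx_fix_pow]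
  · simp
  · simp only [map_sub, map_smul, cxF_E, cxK_self, hk, smul_eq_mul]
    linear_combination -hp
  · simp only [map_sub, map_smul, cxF_E, cxK_self, hk', smul_eq_mul]
    linear_combination -hq

end Geom
section Roots

open Real CoxeterSystem

variable {B : Type} [Fintype B] [DecidableEq B] {M : CoxeterMatrix B} {W : Type*} [Group W]
  (cs : CoxeterSystem M W)

/-- The geometric representation. -/
noncomputable def cxR : W →* Module.End ℝ (B → ℝ) := cs.lift ⟨cxS M, cx_liftable M⟩

@[simp] theorem cxR_simple (i : B) : cxR cs (cs.simple i) = cxS M i :=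
  cs.lift_apply_simple (cx_liftable M) i

theorem cxR_mul (u v : W) (x : B → ℝ) : cxR cs (u * v) x = cxR cs u (cxR cs v x) := by
  rw [map_mul]; rfl

@[simp] theorem cxR_inv_apply (u : W) (x : B → ℝ) : cxR cs u⁻¹ (cxR cs u x) = x := by
  rw [← cxR_mul]; simp

@[simp] theorem cxR_apply_inv (u : W) (x : B → ℝ) : cxR cs u (cxR cs u⁻¹ x) = x := by
  rw [← cxR_mul]; simp

theorem cxR_alt (s t : B) (k : ℕ) :
    cxR cs (cs.wordProd (alternatingWord s t k)) (cxE s) =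
      if Even k then cxA (π / M s t) (k+1) • cxE s + cxA (π / M s t) k • cxE t
      else cxA (π / M s t) (k+1) • cxE t + cxA (π / M s t) k • cxE s := by
  have hk : cxK M s t = -(2 * cos (π / M s t)) := by rw [cxK]; ring
  have hk' : cxK M t s = -(2 * cos (π / M s t)) := by rw [cxK_symm, hk]
  induction k with
  | zero => simp [alternatingWord, cxA]
  | succ k ih =>
    have a1 : cxA (π / M s t) (k + 1 + 1) = 2 * cos (π / M s t) * cxA (π / M s t) (k + 1)
      - cxA (π / M s t) k := rfl
    rw [alternatingWord_succ', cs.wordProd_cons, cxR_mul, ih, a1]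
    simp only [Nat.even_add_one]
    generalize 2 * cos (π / M s t) = c at *
    by_cases h : Even k
    · simp only [h, if_true, not_true, if_false, cxR_simple]
      simp only [map_add, map_smul, map_sub, cxS_E, hk, hk', cxK_self]
      module
    · simp only [h, if_true, not_false_iff, if_false, cxR_simple]
      simp only [map_add, map_smul, map_sub, cxS_E, hk, hk', cxK_self]
      module

theorem cxE_nonneg (i : B) : 0 ≤ cxE i := by
  intro j; by_cases h : j = i
  · subst h; simp
  · simp [h]

/-- Key theorem: non-descents give nonnegative roots. -/
theorem cxR_nonneg_aux (n : ℕ) : ∀ w : W, cs.length w = n → ∀ s : B,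
    cs.length w < cs.length (w * cs.simple s) → 0 ≤ cxR cs w (cxE s) := by
  induction n using Nat.strong_induction_on with
  | _ n ih =>
  intro w hw s hs
  by_cases h1 : w = 1
  · subst h1; simp
  obtain ⟨t, ht⟩ := cs.exists_rightDescent_of_ne_one h1
  have ht' := cs.isRightDescent_iff.1 ht
  have hst : s ≠ t := by
    rintro rfl
    exact absurd ht (by unfold IsRightDescent; omega)
  let P : ℕ → Prop := fun k => ∃ v, w = v * cs.wordProd (alternatingWord s t k) ∧
    cs.length v + k = cs.length w
  have hP0 : P 0 := ⟨w, by simp [alternatingWord], rfl⟩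
  have hP1 : P 1 := ⟨w * cs.simple t, by simp [alternatingWord], ht'⟩
  have hPm : M s t ≠ 0 → ¬ P (M s t) := by
    rintro hm ⟨v, hv, hl⟩
    have hb := cs.wordProd_braidWord_eq s t
    unfold braidWord at hb
    rw [hb, M.symmetric t s] at hv
    obtain ⟨m, hm'⟩ := Nat.exists_eq_succ_of_ne_zero hm
    rw [hm', Nat.succ_eq_add_one, alternatingWord_succ, cs.wordProd_concat, ← mul_assoc] at hv
    have : w * cs.simple s = v * cs.wordProd (alternatingWord s t m) := by
      rw [hv]; simp
    have h2 := cs.length_mul_le v (cs.wordProd (alternatingWord s t m))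
    have h3 := cs.length_wordProd_le (alternatingWord s t m)
    rw [length_alternatingWord] at h3
    rw [← this] at h2
    omega
  have hex : ∃ k, ¬ P k := ⟨cs.length w + 1, by rintro ⟨v, _, hl⟩; omega⟩
  classical
  have hfind := Nat.find_spec hex
  have hmin : ∀ j, j < Nat.find hex → P j := fun j hj => by
    have := Nat.find_min hex hj
    simpa using this
  have hle : M s t ≠ 0 → Nat.find hex ≤ M s t := fun h => Nat.find_min' hex (hPm h)
  generalize Nat.find hex = N at *
  obtain ⟨k, rfl⟩ : ∃ k, N = k + 2 := by
    rcases N with _ | _ | k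
    · exact absurd hP0 hfind
    · exact absurd hP1 hfind
    · exact ⟨k, rfl⟩
  obtain ⟨v, hv, hl⟩ := hmin (k+1) (by omega)
  -- first letter of the word
  have hy1 : cs.length v < cs.length (v * cs.simple (if Even k then t else s)) := by
    by_contra hc
    have hne := cs.length_mul_simple_ne v (if Even k then t else s)
    rw [alternatingWord_succ', cs.wordProd_cons, ← mul_assoc] at hv
    have h2 := cs.length_mul_le (v * cs.simple (if Even k then t else s))
      (cs.wordProd (alternatingWord s t k))
    have h3 := cs.length_wordProd_le (alternatingWord s t k)
    rw [length_alternatingWord] at h3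
    rw [← hv] at h2
    omega
  have hy2 : cs.length v < cs.length (v * cs.simple (if Even (k+1) then t else s)) := by
    by_contra hc
    have hne := cs.length_mul_simple v (if Even (k+1) then t else s)
    apply hfind
    refine ⟨v * cs.simple (if Even (k+1) then t else s), ?_, ?_⟩
    · rw [alternatingWord_succ', cs.wordProd_cons, ← mul_assoc, hv]; simp
    · omega
  have hboth : cs.length v < cs.length (v * cs.simple s) ∧
      cs.length v < cs.length (v * cs.simple t) := by
    simp only [Nat.even_add_one] at hy2
    by_cases h : Even k
    · simp only [h, if_true, not_true, if_false] at hy1 hy2; exact ⟨hy2, hy1⟩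
    · simp only [h, if_true, not_false_iff, if_false] at hy1 hy2; exact ⟨hy1, hy2⟩
  have is := ih _ (by omega) v rfl s hboth.1
  have it := ih _ (by omega) v rfl t hboth.2
  have hm1 : M s t ≠ 1 := M.off_diagonal s t hst
  have n1 : 0 ≤ cxA (π / M s t) (k+1) :=
    cxA_nonneg hm1 (fun h => by have := hle h; omega)
  have n2 : 0 ≤ cxA (π / M s t) (k+1+1) :=
    cxA_nonneg hm1 (fun h => by have := hle h; omega)
  rw [hv, cxR_mul, cxR_alt]
  split_ifs
  · rw [map_add, map_smul, map_smul]
    exact add_nonneg (smul_nonneg n2 is) (smul_nonneg n1 it)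
  · rw [map_add, map_smul, map_smul]
    exact add_nonneg (smul_nonneg n2 it) (smul_nonneg n1 is)

theorem cxR_nonneg (w : W) (s : B) (h : ¬ cs.IsRightDescent w s) : 0 ≤ cxR cs w (cxE s) := by
  refine cxR_nonneg_aux cs _ w rfl s ?_
  rw [cs.not_isRightDescent_iff] at h
  omega

theorem cxR_nonpos (w : W) (s : B) (h : cs.IsRightDescent w s) : cxR cs w (cxE s) ≤ 0 := by
  have h2 := cs.isRightDescent_iff_not_isRightDescent_mul.1 h
  have h3 := cxR_nonneg cs _ s h2
  rw [cxR_mul, cxR_simple, cxS_E_self, map_neg] at h3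
  exact neg_nonneg.1 h3

theorem cxE_ne_zero (i : B) : cxE i ≠ 0 := by
  intro h; have := congrFun h i; simp at this

theorem cxR_inj {w : W} {x y : B → ℝ} (h : cxR cs w x = cxR cs w y) : x = y := by
  have := congrArg (cxR cs w⁻¹) h
  simpa using this

theorem cxR_ne_zero {w : W} {x : B → ℝ} (h : x ≠ 0) : cxR cs w x ≠ 0 := by
  intro h0; apply h; apply cxR_inj cs (w := w); simpa using h0

theorem cx_exists_nonpos {w : W} (h : w ≠ 1) : ∃ s, cs.IsRightDescent w s ∧
    cxR cs w (cxE s) ≤ 0 := by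
  obtain ⟨s, hs⟩ := cs.exists_rightDescent_of_ne_one h
  exact ⟨s, hs, cxR_nonpos cs w s hs⟩

/-- faithfulness -/
theorem cxR_faithful {w : W} (h : ∀ s, cxR cs w (cxE s) = cxE s) : w = 1 := by
  by_contra hw
  obtain ⟨s, _, hs⟩ := cx_exists_nonpos cs hw
  rw [h] at hs
  exact cxE_ne_zero s (le_antisymm hs (cxE_nonneg s))

/-- Roots. -/
def cxRoots : Set (B → ℝ) := {β | ∃ w i, β = cxR cs w (cxE i)}

theorem cxRoots_smul {β : B → ℝ} (h : β ∈ cxRoots cs) (w : W) : cxR cs w β ∈ cxRoots cs := by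
  obtain ⟨u, i, rfl⟩ := h
  exact ⟨w * u, i, by rw [cxR_mul]⟩

theorem cxRoots_neg {β : B → ℝ} (h : β ∈ cxRoots cs) : -β ∈ cxRoots cs := by
  obtain ⟨u, i, rfl⟩ := h
  exact ⟨u * cs.simple i, i, by rw [cxR_mul, cxR_simple, cxS_E_self, map_neg]⟩

theorem cxRoots_simple (i : B) : cxE i ∈ cxRoots cs := ⟨1, i, by simp⟩

theorem cxRoots_pos_or_neg {β : B → ℝ} (h : β ∈ cxRoots cs) : 0 ≤ β ∨ β ≤ 0 := by
  obtain ⟨u, i, rfl⟩ := h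
  by_cases hd : cs.IsRightDescent u i
  · exact Or.inr (cxR_nonpos cs u i hd)
  · exact Or.inl (cxR_nonneg cs u i hd)

theorem cxRoots_ne_zero {β : B → ℝ} (h : β ∈ cxRoots cs) : β ≠ 0 := by
  obtain ⟨u, i, rfl⟩ := h
  exact cxR_ne_zero cs (cxE_ne_zero i)

/-- invariant quadratic form -/
noncomputable def cxQ (M : CoxeterMatrix B) (v : B → ℝ) : ℝ := ∑ i, v i * cxF M i v

theorem cxQ_S (i : B) (v : B → ℝ) : cxQ M (cxS M i v) = cxQ M v := by
  have hsum : ∑ j, v j * cxK M j i = cxF M i v := by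
    rw [cxF_apply]; refine Finset.sum_congr rfl fun j _ => ?_
    rw [cxK_symm]; ring
  have h1 : ∀ j, cxF M j (cxS M i v) = cxF M j v - cxF M i v * cxK M j i := by
    intro j; rw [cxS_apply, map_sub, map_smul, cxF_E, smul_eq_mul]
  have h2 : cxF M i (cxS M i v) = - cxF M i v := by rw [h1, cxK_self]; ring
  have h3 : cxQ M (cxS M i v) = ∑ j, v j * cxF M j (cxS M i v)
      - cxF M i v * cxF M i (cxS M i v) := by
    unfold cxQ
    have : ∀ j, cxS M i v j = v j - cxF M i v * (if j = i then 1 else 0) := by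
      intro j; rw [cxS_apply]; simp [Pi.single_apply]
    simp_rw [this, sub_mul, Finset.sum_sub_distrib]
    simp
  rw [h3, h2]
  simp_rw [h1, mul_sub, Finset.sum_sub_distrib]
  have : ∑ j, v j * (cxF M i v * cxK M j i) = cxF M i v * cxF M i v := by
    rw [← hsum, Finset.mul_sum]
    rw [hsum]
    refine Finset.sum_congr rfl fun j _ => by ring
  rw [this, cxQ]; ring

theorem cxQ_R (w : W) (v : B → ℝ) : cxQ M (cxR cs w v) = cxQ M v := by
  induction w using cs.simple_induction_left with
  | one => simp
  | mul_simple_left w i ih => rw [cxR_mul, cxR_simple, cxQ_S, ih]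

theorem cxQ_E (i : B) (c : ℝ) : cxQ M (c • cxE i) = 2 * c ^ 2 := by
  unfold cxQ
  simp [Pi.single_apply, cxK_self]
  ring

theorem cxRoot_multiple {β : B → ℝ} (h : β ∈ cxRoots cs) (i : B) (h0 : 0 ≤ β)
    (hm : ∀ j, j ≠ i → β j = 0) : β = cxE i := by
  have hb : β = β i • cxE i := by
    ext j; by_cases hj : j = i
    · subst hj; simp
    · simp [hj, hm j hj]
  have hq : cxQ M β = 2 := by
    obtain ⟨u, k, rfl⟩ := h
    rw [cxQ_R]; have := cxQ_E (M := M) k 1; simpa using this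
  rw [hb, cxQ_E] at hq
  have h1 : β i = 1 := by
    have := h0 i
    simp only [Pi.zero_apply] at this
    nlinarith
  rw [hb, h1, one_smul]

/-- A simple reflection permutes the positive roots other than its own. -/
theorem cx_simple_pos {β : B → ℝ} (h : β ∈ cxRoots cs) (h0 : 0 ≤ β) (i : B) (hne : β ≠ cxE i) :
    0 ≤ cxS M i β := by
  have hr : cxS M i β ∈ cxRoots cs := by
    have := cxRoots_smul cs h (cs.simple i); rwa [cxR_simple] at this
  rcases cxRoots_pos_or_neg cs hr with h1 | h1
  · exact h1
  · exfalso
    apply hne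
    apply cxRoot_multiple cs h i h0
    intro j hj
    have h2 := h1 j
    have h3 := h0 j
    rw [cxS_apply] at h2
    simp [hj] at h2 h3
    linarith

/-- Inversion set. -/
def cxInv (w : W) : Set (B → ℝ) := {β | β ∈ cxRoots cs ∧ 0 ≤ β ∧ cxR cs w β ≤ 0}

theorem cxInv_finite (w : W) : (cxInv cs w).Finite := by
  induction w using cs.simple_induction_right with
  | one =>
    convert Set.finite_empty
    ext β
    simp only [cxInv, Set.mem_ofPred_eq, Set.mem_empty_iff_false, iff_false]
    rintro ⟨h, h0, h1⟩
    rw [map_one] at h1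
    exact cxRoots_ne_zero cs h (le_antisymm h1 h0)
  | mul_simple_right w i ih =>
    refine ((ih.image (cxS M i)).union (Set.finite_singleton (cxE i))).subset ?_
    rintro β ⟨h, h0, h1⟩
    by_cases hne : β = cxE i
    · right; exact hne
    · left
      refine ⟨cxS M i β, ⟨?_, cx_simple_pos cs h h0 i hne, ?_⟩, ?_⟩
      · have := cxRoots_smul cs h (cs.simple i); rwa [cxR_simple] at this
      · rwa [cxR_mul, cxR_simple] at h1
      · have := congrArg (fun f => f β) (cxS_sq M i)
        exact this

theorem cxInv_inj {a b : W} (h : cxInv cs a = cxInv cs b) : a = b := by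
  by_contra hne
  have h1 : a * b⁻¹ ≠ 1 := fun h => hne (mul_inv_eq_one.1 h)
  obtain ⟨t, _, ht⟩ := cx_exists_nonpos cs h1
  rw [cxR_mul] at ht
  have hγ : cxR cs b⁻¹ (cxE t) ∈ cxRoots cs := ⟨_, _, rfl⟩
  have hbγ : cxR cs b (cxR cs b⁻¹ (cxE t)) = cxE t := by simp
  generalize cxR cs b⁻¹ (cxE t) = γ at *
  rcases cxRoots_pos_or_neg cs hγ with h0 | h0
  · have : γ ∈ cxInv cs a := ⟨hγ, h0, ht⟩
    rw [h] at this
    have h2 := this.2.2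
    rw [hbγ] at h2
    exact cxE_ne_zero t (le_antisymm h2 (cxE_nonneg t))
  · have : -γ ∈ cxInv cs b := ⟨cxRoots_neg cs hγ, neg_nonneg.2 h0, by
      rw [map_neg, hbγ]; exact neg_nonpos.2 (cxE_nonneg t)⟩
    rw [← h] at this
    have h2 := this.2.2
    rw [map_neg] at h2
    have h3 := le_antisymm ht (neg_nonpos.1 h2)
    exact cxR_ne_zero cs (cxRoots_ne_zero cs hγ) h3

end Roots
section Parabolic

open Real CoxeterSystem

variable {B : Type} [Fintype B] [DecidableEq B] {M : CoxeterMatrix B} {W : Type*} [Group W]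
  (cs : CoxeterSystem M W)

/-- Standard parabolic subgroup. -/
def cxP (I : Set B) : Subgroup W := Subgroup.closure (cs.simple '' I)

theorem cxP_simple {I : Set B} {i : B} (h : i ∈ I) : cs.simple i ∈ cxP cs I :=
  Subgroup.subset_closure ⟨i, h, rfl⟩

theorem cxP_mono {I J : Set B} (h : I ⊆ J) : cxP cs I ≤ cxP cs J :=
  Subgroup.closure_mono (Set.image_mono h)

theorem cx_expand (T : Module.End ℝ (B → ℝ)) (v : B → ℝ) : T v = ∑ i, v i • T (cxE i) := by
  conv_lhs => rw [← Finset.univ_sum_single v]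
  rw [map_sum]
  refine Finset.sum_congr rfl fun i _ => ?_
  rw [← map_smul]; congr 1
  ext j; by_cases h : j = i
  · subst h; simp
  · simp [h]

theorem cx_expand_fun (T : (B → ℝ) →ₗ[ℝ] ℝ) (v : B → ℝ) : T v = ∑ i, v i * T (cxE i) := by
  conv_lhs => rw [← Finset.univ_sum_single v]
  rw [map_sum]
  refine Finset.sum_congr rfl fun i _ => ?_
  rw [← smul_eq_mul, ← map_smul]; congr 1
  ext j; by_cases h : j = i
  · subst h; simp
  · simp [h]

theorem cx_dom_nonpos (f : (B → ℝ) →ₗ[ℝ] ℝ) (hf : ∀ s, 0 ≤ f (cxE s)) (v : B → ℝ) (hv : v ≤ 0) :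
    f v ≤ 0 := by
  rw [cx_expand_fun]
  exact Finset.sum_nonpos fun i _ => mul_nonpos_of_nonpos_of_nonneg (hv i) (hf i)

theorem cx_stab_aux (f : (B → ℝ) →ₗ[ℝ] ℝ) (hf : ∀ s, 0 ≤ f (cxE s)) (n : ℕ) :
    ∀ u : W, cs.length u = n → (∀ v, f (cxR cs u v) = f v) →
    u ∈ cxP cs {s | f (cxE s) = 0} := by
  induction n with
  | zero => intro u hu _; rw [cs.length_eq_zero_iff] at hu; rw [hu]; exact one_mem _
  | succ n ih =>
    intro u hu hst
    have h1 : u ≠ 1 := by rintro rfl; simp at hu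
    obtain ⟨s, hd, hs⟩ := cx_exists_nonpos cs h1
    have h2 := cx_dom_nonpos f hf _ hs
    rw [hst] at h2
    have h3 : f (cxE s) = 0 := le_antisymm h2 (hf s)
    have h4 := cs.isRightDescent_iff.1 hd
    have h5 := ih (u * cs.simple s) (by omega) (by
      intro v
      rw [cxR_mul, hst, cxR_simple, cxS_apply, map_sub, map_smul, h3]; simp)
    have h6 := mul_mem h5 (cxP_simple cs (show s ∈ {s | f (cxE s) = 0} from h3))
    simpa using h6

theorem cx_stab_mem (f : (B → ℝ) →ₗ[ℝ] ℝ) (u : W) (hu : u ∈ cxP cs {s | f (cxE s) = 0}) :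
    ∀ v, f (cxR cs u v) = f v := by
  induction hu using Subgroup.closure_induction with
  | mem x hx =>
    obtain ⟨s, hs, rfl⟩ := hx
    intro v
    have hs' : f (cxE s) = 0 := hs
    rw [cxR_simple, cxS_apply, map_sub, map_smul, hs']; simp
  | one => intro v; simp
  | mul x y _ _ hx hy => intro v; rw [cxR_mul, hx, hy]
  | inv x _ hx => intro v; rw [← hx]; simp

theorem cx_stab_finite (f : (B → ℝ) →ₗ[ℝ] ℝ) (hf : ∀ s, 0 ≤ f (cxE s))
    (hfin : {β | β ∈ cxRoots cs ∧ 0 ≤ β ∧ f β ≤ 0}.Finite) :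
    Finite (cxP cs {s | f (cxE s) = 0}) := by
  set Z : Set (B → ℝ) := {β | β ∈ cxRoots cs ∧ f β = 0} with hZ
  have hZf : Z.Finite := by
    refine (hfin.union (hfin.image (fun v => -v))).subset ?_
    rintro β ⟨h, h0⟩
    rcases cxRoots_pos_or_neg cs h with hp | hn
    · left; exact ⟨h, hp, h0.le⟩
    · right
      exact ⟨-β, ⟨cxRoots_neg cs h, neg_nonneg.2 hn, by rw [map_neg, h0]; simp⟩, by simp⟩
  have : Finite Z := hZf
  let g : cxP cs {s | f (cxE s) = 0} → ({s // f (cxE s) = 0} → Z) := fun u s =>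
    ⟨cxR cs u.1 (cxE s.1), cxRoots_smul cs (cxRoots_simple cs s.1) _, by
      rw [cx_stab_mem cs f u.1 u.2, s.2]⟩
  refine Finite.of_injective g ?_
  rintro ⟨u, hu⟩ ⟨v, hv⟩ h
  have h1 : ∀ s, f (cxE s) = 0 → cxR cs u (cxE s) = cxR cs v (cxE s) := by
    intro s hs
    have := congrFun h ⟨s, hs⟩
    exact congrArg Subtype.val this
  ext
  simp only
  by_contra hne
  have hne' : v⁻¹ * u ≠ 1 := fun h => hne (inv_mul_eq_one.1 h).symm
  obtain ⟨s, hd, hs⟩ := cx_exists_nonpos cs hne'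
  have hm : v⁻¹ * u ∈ cxP cs {s | f (cxE s) = 0} := mul_mem (inv_mem hv) hu
  have h2 := cx_dom_nonpos f hf _ hs
  rw [cx_stab_mem cs f _ hm] at h2
  have h3 : f (cxE s) = 0 := le_antisymm h2 (hf s)
  rw [cxR_mul, h1 s h3, cxR_inv_apply] at hs
  exact cxE_ne_zero s (le_antisymm hs (cxE_nonneg s))

/-- Tits: finite subgroups are conjugate into finite standard parabolics. -/
theorem cx_tits (K : Subgroup W) [Finite K] :
    ∃ (g : W) (I : Set B), Finite (cxP cs I) ∧ ∀ k ∈ K, g * k * g⁻¹ ∈ cxP cs I := by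
  have := Fintype.ofFinite K
  let ρ : (B → ℝ) →ₗ[ℝ] ℝ := ∑ i, LinearMap.proj i
  have hρ : ∀ v, ρ v = ∑ i, v i := fun v => by simp [ρ]
  let f : (B → ℝ) →ₗ[ℝ] ℝ := ∑ k : K, ρ ∘ₗ (cxR cs k.1)
  have hf : ∀ v, f v = ∑ k : K, ρ (cxR cs k.1 v) := fun v => by simp [f]
  have hfinv : ∀ k ∈ K, ∀ v, f (cxR cs k v) = f v := by
    intro k hk v
    rw [hf, hf]
    refine Fintype.sum_equiv (Equiv.mulRight ⟨k, hk⟩) _ _ fun a => ?_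
    simp [cxR_mul]
  let N : W → Set (B → ℝ) := fun w => {β | β ∈ cxRoots cs ∧ 0 ≤ β ∧ f (cxR cs w β) ≤ 0}
  have hN1 : {β | β ∈ cxRoots cs ∧ 0 ≤ β ∧ f β ≤ 0}.Finite := by
    refine (Set.finite_iUnion (fun k : K => cxInv_finite cs k.1)).subset ?_
    rintro β ⟨h, h0, h1⟩
    by_contra hc
    simp only [Set.mem_iUnion, not_exists] at hc
    have : 0 < f β := by
      rw [hf]
      refine Finset.sum_pos (fun k _ => ?_) ⟨1, Finset.mem_univ _⟩
      have hr := cxRoots_smul cs h k.1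
      rcases cxRoots_pos_or_neg cs hr with hp | hn
      · rw [hρ]
        refine lt_of_le_of_ne (Finset.sum_nonneg fun i _ => hp i) ?_
        intro he
        apply cxRoots_ne_zero cs hr
        have := (Finset.sum_eq_zero_iff_of_nonneg (fun i _ => hp i)).1 he.symm
        ext i; exact this i (Finset.mem_univ _)
      · exact absurd ⟨h, h0, hn⟩ (hc k)
    linarith
  have hNf : ∀ w, (N w).Finite := by
    intro w
    refine ((hN1.image (cxR cs w⁻¹)).union (cxInv_finite cs w)).subset ?_
    rintro β ⟨h, h0, h1⟩
    rcases cxRoots_pos_or_neg cs (cxRoots_smul cs h w) with hp | hn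
    · left; exact ⟨cxR cs w β, ⟨cxRoots_smul cs h w, hp, h1⟩, by simp⟩
    · right; exact ⟨h, h0, hn⟩
  obtain ⟨w, hw⟩ : ∃ w, ∀ w', (N w).ncard ≤ (N w').ncard :=
    ⟨Function.argmin (fun w => (N w).ncard), fun w' => Function.argmin_le (fun w => (N w).ncard) w'⟩
  have hdom : ∀ s, 0 ≤ f (cxR cs w (cxE s)) := by
    intro s
    by_contra hneg
    push Not at hneg
    have hSS : ∀ v, cxS M s (cxS M s v) = v := fun v => congrArg (fun f => f v) (cxS_sq M s)
    have hinj : Function.Injective (cxS M s) := fun a b hab => by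
      rw [← hSS a, hab, hSS]
    have hss : (cxS M s) '' (N (w * cs.simple s)) ⊂ N w := by
      have hE : cxE s ∉ N (w * cs.simple s) := by
        rintro ⟨_, _, h1⟩
        rw [cxR_mul, cxR_simple, cxS_E_self, map_neg, map_neg] at h1
        linarith
      refine ⟨?_, ?_⟩
      · rintro _ ⟨β, hβ, rfl⟩
        have hne : β ≠ cxE s := by rintro rfl; exact hE hβ
        obtain ⟨h, h0, h1⟩ := hβ
        refine ⟨?_, cx_simple_pos cs h h0 s hne, ?_⟩
        · have := cxRoots_smul cs h (cs.simple s); rwa [cxR_simple] at this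
        · rwa [cxR_mul, cxR_simple] at h1
      · intro hsub
        obtain ⟨β, hβ, hβ'⟩ := hsub (show cxE s ∈ N w from
          ⟨cxRoots_simple cs s, cxE_nonneg s, hneg.le⟩)
        have : β = - cxE s := by rw [← hSS β, hβ', cxS_E_self]
        have h0 := hβ.2.1
        rw [this] at h0
        exact cxE_ne_zero s (le_antisymm (neg_nonneg.1 h0) (cxE_nonneg s))
    have h1 := Set.ncard_lt_ncard hss (hNf w)
    rw [Set.ncard_image_of_injective _ hinj] at h1
    exact absurd (hw (w * cs.simple s)) (by omega)
  let f' : (B → ℝ) →ₗ[ℝ] ℝ := f ∘ₗ (cxR cs w)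
  refine ⟨w⁻¹, {s | f' (cxE s) = 0}, cx_stab_finite cs f' hdom (hNf w), fun k hk => ?_⟩
  refine cx_stab_aux cs f' hdom _ _ rfl fun v => ?_
  show f (cxR cs w (cxR cs _ v)) = f (cxR cs w v)
  rw [← cxR_mul]
  have : w * (w⁻¹ * k * w⁻¹⁻¹) = k * w := by group
  rw [this, cxR_mul, hfinv k hk]

theorem cxP_coord {I : Set B} {u : W} (hu : u ∈ cxP cs I) :
    ∀ (v : B → ℝ) (j : B), j ∉ I → cxR cs u v j = v j := by
  induction hu using Subgroup.closure_induction with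
  | mem x hx =>
    obtain ⟨s, hs, rfl⟩ := hx
    intro v j hj
    have : j ≠ s := by rintro rfl; exact hj hs
    rw [cxR_simple, cxS_apply]; simp [this]
  | one => intro v j _; simp
  | mul x y _ _ hx hy => intro v j hj; rw [cxR_mul, hx _ _ hj, hy _ _ hj]
  | inv x _ hx => intro v j hj; rw [← hx (cxR cs x⁻¹ v) j hj]; simp

theorem cxP_exists_min (I : Set B) (c : W) : ∃ u ∈ cxP cs I, ∀ i ∈ I,
    ¬ cs.IsRightDescent (c * u) i := by
  let F : cxP cs I → ℕ := fun u => cs.length (c * u.1)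
  obtain ⟨u, hu⟩ : ∃ u, ∀ u', F u ≤ F u' := ⟨Function.argmin F, fun u' => Function.argmin_le F u'⟩
  refine ⟨u.1, u.2, fun i hi hd => ?_⟩
  have h1 := hu (u * ⟨cs.simple i, cxP_simple cs hi⟩)
  simp only [F, Subgroup.coe_mul, ← mul_assoc] at h1
  unfold IsRightDescent at hd
  omega

theorem cx_centralizer {I : Set B} (hI : Maximal (fun I : Set B => Finite (cxP cs I)) I)
    (c : W) (hc : ∀ h ∈ cxP cs I, c * h = h * c) : c ∈ cxP cs I := by
  obtain ⟨u, hu, hmin⟩ := cxP_exists_min cs I c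
  by_cases hx1 : c * u = 1
  · rw [mul_eq_one_iff_eq_inv.1 hx1]; exact inv_mem hu
  exfalso
  -- elements commuting with the parabolic scale its simple roots
  have hscale : ∀ d : W, (∀ h ∈ cxP cs I, d * h = h * d) → ∀ v : B → ℝ, (∀ j ∉ I, v j = 0) →
      ∀ j ∉ I, cxR cs d v j = 0 := by
    intro d hd v hv j hj
    rw [cx_expand, Finset.sum_apply]
    refine Finset.sum_eq_zero fun i _ => ?_
    by_cases hi : i ∈ I
    · have h1 : cxR cs (d * cs.simple i) (cxE i) = cxR cs (cs.simple i * d) (cxE i) := by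
        rw [hd _ (cxP_simple cs hi)]
      rw [cxR_mul, cxR_mul, cxR_simple, cxS_E_self, map_neg, cxS_apply] at h1
      have h2 := congrFun h1 j
      have hij : j ≠ i := by rintro rfl; exact hj hi
      simp [hij] at h2
      have h3 : cxR cs d (cxE i) j = 0 := by linarith
      rw [Pi.smul_apply, h3, smul_zero]
    · simp [hv i hi]
  have hcinv : ∀ h ∈ cxP cs I, c⁻¹ * h = h * c⁻¹ := by
    intro h hh
    have := hc h hh
    rw [inv_mul_eq_iff_eq_mul, ← mul_assoc, this]; simp
  set x := c * u with hx
  have hxS : ∀ v : B → ℝ, (∀ j ∉ I, v j = 0) → ∀ j ∉ I, cxR cs x v j = 0 := by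
    intro v hv j hj
    rw [hx, cxR_mul]
    refine hscale c hc _ (fun j hj => ?_) j hj
    rw [cxP_coord cs hu _ _ hj, hv j hj]
  have hxS' : ∀ v : B → ℝ, (∀ j ∉ I, v j = 0) → ∀ j ∉ I, cxR cs x⁻¹ v j = 0 := by
    intro v hv j hj
    rw [hx, mul_inv_rev, cxR_mul, cxP_coord cs (inv_mem hu) _ _ hj]
    exact hscale _ hcinv _ hv j hj
  obtain ⟨s, hd, hs⟩ := cx_exists_nonpos cs hx1
  have hsI : s ∉ I := fun h => hmin s h hd
  obtain ⟨j, hj, hjneg⟩ : ∃ j ∉ I, cxR cs x (cxE s) j < 0 := by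
    by_contra hcon
    push Not at hcon
    have h1 : ∀ j ∉ I, cxR cs x (cxE s) j = 0 := fun j hj => le_antisymm (hs j) (hcon j hj)
    have h2 := hxS' _ h1 s hsI
    rw [cxR_inv_apply] at h2
    simp at h2
  -- key inclusion
  have key : ∀ y ∈ cxP cs (insert s I), (∀ i ∈ I, ¬ cs.IsRightDescent y i) →
      cxInv cs y ⊆ cxInv cs x := by
    rintro y hy hyd β ⟨h, h0, h1⟩
    have hout : ∀ k, k ∉ insert s I → β k = 0 := by
      intro k hk
      have h2 := h1 k
      rw [cxP_coord cs hy _ _ hk] at h2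
      exact le_antisymm h2 (h0 k)
    have hβs : β s ≠ 0 := by
      intro hz
      have hnn : 0 ≤ cxR cs y β := by
        rw [cx_expand]
        refine Finset.sum_nonneg fun i _ => ?_
        by_cases hi : i ∈ I
        · exact smul_nonneg (h0 i) (cxR_nonneg cs y i (hyd i hi))
        · have : β i = 0 := by
            by_cases his : i = s
            · rw [his, hz]
            · exact hout i (by simp [his, hi])
          rw [this, zero_smul]
      exact cxR_ne_zero cs (cxRoots_ne_zero cs h) (le_antisymm h1 hnn)
    have hβpos : 0 < β s := lt_of_le_of_ne (h0 s) (Ne.symm hβs)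
    have hval : cxR cs x β j = β s * cxR cs x (cxE s) j := by
      rw [cx_expand, Finset.sum_apply, Finset.sum_eq_single s]
      · simp
      · intro i _ his
        by_cases hi : i ∈ I
        · have h5 : cxR cs x (cxE i) j = 0 := by
            refine hxS _ (fun k hk => ?_) j hj
            have : k ≠ i := by rintro rfl; exact hk hi
            simp [this]
          rw [Pi.smul_apply, h5, smul_zero]
        · rw [hout i (by simp [his, hi])]; simp
      · simp
    refine ⟨h, h0, ?_⟩
    rcases cxRoots_pos_or_neg cs (cxRoots_smul cs h x) with hp | hn
    · have h6 := hp j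
      rw [hval] at h6
      have h7 : β s * cxR cs x (cxE s) j < 0 := mul_neg_of_pos_of_neg hβpos hjneg
      exact absurd h6 (not_le.2 h7)
    · exact hn
  have hfin : Finite (cxP cs (insert s I)) := by
    have hIf : Finite (cxP cs I) := hI.prop
    set V : Set W := {v | cxInv cs v⁻¹ ⊆ cxInv cs x} with hV
    have hVf : V.Finite := by
      refine Set.Finite.of_finite_image (f := fun v => cxInv cs v⁻¹)
        ((cxInv_finite cs x).finite_subsets.subset ?_) ?_
      · rintro _ ⟨v, hv, rfl⟩; exact hv
      · intro a _ b _ hab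
        exact inv_injective (cxInv_inj cs hab)
    have hIs : (cxP cs I : Set W).Finite := hIf
    refine (Set.Finite.image2 (fun a b => a * b) hIs hVf).subset ?_
    intro w hw
    obtain ⟨u', hu', hm'⟩ := cxP_exists_min cs I w⁻¹
    refine ⟨u', hu', u'⁻¹ * w, ?_, by simp⟩
    show cxInv cs (u'⁻¹ * w)⁻¹ ⊆ cxInv cs x
    have : (u'⁻¹ * w)⁻¹ = w⁻¹ * u' := by group
    rw [this]
    exact key _ (mul_mem (inv_mem hw) (cxP_mono cs (Set.subset_insert s I) hu')) hm'
  exact hsI (hI.le_of_ge hfin (Set.subset_insert s I) (Set.mem_insert s I))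

theorem cx_exists_maximal : ∃ I : Set B, Maximal (fun I : Set B => Finite (cxP cs I)) I := by
  refine Set.Finite.exists_maximal (s := {I : Set B | Finite (cxP cs I)}) (Set.toFinite _) ⟨∅, ?_⟩
  show Finite (cxP cs ∅)
  rw [cxP, Set.image_empty, Subgroup.closure_empty]
  infer_instance

end Parabolic
section RF

open Real CoxeterSystem

theorem cx_free_ring_rf (R : Type) [CommRing R] [Module.Finite ℤ R] [Module.Free ℤ R]
    (r : R) (hr : r ≠ 0) : ∃ n : ℕ, Finite (R ⧸ Ideal.span {(n : R)}) ∧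
      Ideal.Quotient.mk (Ideal.span {(n : R)}) r ≠ 0 := by
  let b := Module.Free.chooseBasis ℤ R
  obtain ⟨i, hi⟩ : ∃ i, b.repr r i ≠ 0 := by
    by_contra hcon
    push Not at hcon
    apply hr
    apply b.repr.injective
    ext i; simp [hcon i]
  refine ⟨(b.repr r i).natAbs + 1, ?_, ?_⟩
  · refine Module.finite_of_fg_torsion _ ?_
    intro x
    refine ⟨⟨(((b.repr r i).natAbs + 1 : ℕ) : ℤ), ?_⟩, ?_⟩
    · rw [mem_nonZeroDivisors_iff_ne_zero]; positivity
    · obtain ⟨y, rfl⟩ := Ideal.Quotient.mk_surjective x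
      show (((b.repr r i).natAbs + 1 : ℕ) : ℤ) •
        (Ideal.Quotient.mk (Ideal.span {(((b.repr r i).natAbs + 1 : ℕ) : R)}) y) = 0
      rw [← map_zsmul, Ideal.Quotient.eq_zero_iff_mem, zsmul_eq_mul]
      apply Ideal.mul_mem_right
      simpa using Ideal.subset_span (Set.mem_singleton _)
  · rw [Ne, Ideal.Quotient.eq_zero_iff_mem, Ideal.mem_span_singleton]
    rintro ⟨y, hy⟩
    have h1 : r = (((b.repr r i).natAbs + 1 : ℕ) : ℤ) • y := by
      rw [zsmul_eq_mul]; exact_mod_cast hy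
    have h2 : b.repr r i = (((b.repr r i).natAbs + 1 : ℕ) : ℤ) * b.repr y i := by
      conv_lhs => rw [h1]
      rw [map_zsmul]; simp
    have h3 : (((b.repr r i).natAbs + 1 : ℕ) : ℤ) ∣ b.repr r i := ⟨_, h2⟩
    have h4 := Int.natAbs_dvd_natAbs.2 h3
    have h5 := Nat.le_of_dvd (Int.natAbs_pos.2 hi) h4
    simp only [Int.natAbs_natCast] at h5
    omega

theorem cx_isIntegral_two_cos (m : ℕ) : IsIntegral ℤ (-2 * cos (π / m)) := by
  have h := (isIntegral_two_mul_cos_rat_mul_pi (1 / m)).neg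
  convert h using 1
  push_cast
  rw [one_div_mul_eq_div]; ring

theorem cx_residually_finite {B : Type} [Fintype B] [DecidableEq B] {M : CoxeterMatrix B}
    {W : Type*} [Group W] (cs : CoxeterSystem M W) : ResiduallyFinite W := by
  intro w hw
  let R : Subalgebra ℤ ℝ := Algebra.adjoin ℤ (Set.range fun p : B × B => cxK M p.1 p.2)
  have hfin : Module.Finite ℤ R := by
    refine Module.Finite.iff_fg.2 (fg_adjoin_of_finite (Set.finite_range _) ?_)
    rintro _ ⟨p, rfl⟩
    exact cx_isIntegral_two_cos _
  have hfree : Module.Free ℤ R := inferInstance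
  let κ : B → B → R := fun i j => ⟨cxK M i j, Algebra.subset_adjoin ⟨(i, j), rfl⟩⟩
  let S : B → Matrix B B R := fun i => Matrix.of fun a b =>
    (if a = b then 1 else 0) - (if a = i then κ i b else 0)
  let ι : Matrix B B R →* Module.End ℝ (B → ℝ) :=
    ((Matrix.toLinAlgEquiv' (R := ℝ) (n := B)).toRingEquiv.toRingHom.comp
      (R.val.toRingHom.mapMatrix)).toMonoidHom
  have hι : ∀ (A : Matrix B B R) (a b : B), ι A (cxE b) a = (A a b : ℝ) := by
    intro A a b
    simp [ι, cxE, Matrix.toLinAlgEquiv'_apply]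
  have hιinj : Function.Injective ι := by
    intro A A' h
    ext a b
    rw [← hι, ← hι, h]
  have hιS : ∀ i, ι (S i) = cxS M i := by
    intro i
    refine LinearMap.pi_ext' fun b => LinearMap.ext_ring ?_
    ext a
    show ι (S i) (cxE b) a = cxS M i (cxE b) a
    rw [hι, cxS_E]
    by_cases h1 : a = b <;> by_cases h2 : a = i <;> simp [S, κ, h1, h2, Pi.single_apply] <;> simp_all
  have hlift : M.IsLiftable S := by
    intro i j
    apply hιinj
    rw [map_pow, map_mul, hιS, hιS, map_one]
    exact cx_liftable M i j
  let ρ : W →* Matrix B B R := cs.lift ⟨S, hlift⟩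
  have hρ : ι.comp ρ = cxR cs := by
    refine cs.ext_simple fun i => ?_
    rw [cxR_simple, MonoidHom.comp_apply, ← hιS]
    congr 1
    exact cs.lift_apply_simple hlift i
  have hρw : ρ w ≠ 1 := by
    intro h
    apply hw
    apply cxR_faithful cs
    intro s
    rw [← hρ, MonoidHom.comp_apply, h, map_one]; rfl
  obtain ⟨a, b, hab⟩ : ∃ a b, ρ w a b - (1 : Matrix B B R) a b ≠ 0 := by
    by_contra hcon
    push Not at hcon
    apply hρw
    ext a b
    rw [sub_eq_zero.1 (hcon a b)]
  obtain ⟨n, hn1, hn2⟩ := cx_free_ring_rf R _ hab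
  let q := Ideal.Quotient.mk (Ideal.span {(n : R)})
  let π' : W →* Matrix B B (R ⧸ Ideal.span {(n : R)}) :=
    (q.mapMatrix : Matrix B B R →+* Matrix B B _).toMonoidHom.comp ρ
  have : Finite (Matrix B B (R ⧸ Ideal.span {(n : R)})) :=
    inferInstanceAs (Finite (B → B → (R ⧸ Ideal.span {(n : R)})))
  refine ⟨(Matrix B B (R ⧸ Ideal.span {(n : R)}))ˣ, inferInstance, inferInstance,
    π'.toHomUnits, ?_⟩
  intro h
  have h1 : π' w = 1 := congrArg Units.val h
  apply hn2
  have h2 := congrFun (congrFun h1 a) b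
  have h3 : q (ρ w a b) = (1 : Matrix B B (R ⧸ Ideal.span {(n : R)})) a b := h2
  rw [map_sub, sub_eq_zero]
  show q _ = q _
  rw [h3, Matrix.one_apply, Matrix.one_apply]
  split_ifs <;> simp

end RF

section Criterion

theorem cx_rf_finite {G : Type*} [Group G] (h : ResiduallyFinite G) {ι : Type} [Finite ι]
    (x : ι → G) : ∃ (F : Type) (_ : Group F) (_ : Finite F) (φ : G →* F),
      ∀ i, φ (x i) = 1 → x i = 1 := by
  classical
  have h' : ∀ i, ∃ (F : Type) (_ : Group F) (_ : Finite F) (φ : G →* F),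
      φ (x i) = 1 → x i = 1 := by
    intro i
    by_cases hi : x i = 1
    · exact ⟨Unit, inferInstance, inferInstance, 1, fun _ => hi⟩
    · obtain ⟨F, g, f, φ, hφ⟩ := h _ hi
      exact ⟨F, g, f, φ, fun h => absurd h hφ⟩
  choose F g f φ hφ using h'
  refine ⟨∀ i, F i, inferInstance, inferInstance, MonoidHom.pi φ, fun i hi => hφ i ?_⟩
  exact congrFun hi i

theorem cx_criterion {G : Type*} [Group G] {ι : Type} [Finite ι] (gen : ι → G)
    (hgen : Subgroup.closure (Set.range gen) = ⊤) (hrf : ResiduallyFinite G)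
    (H : Subgroup G) [Finite H] (X : Set G) (hX : X.Finite)
    (hconj : ∀ φ : MulAut G, ∃ g : G, ∀ h ∈ H, g * φ h * g⁻¹ ∈ X)
    (hcent : ∀ c : G, (∀ h ∈ H, c * h = h * c) → c ∈ H) :
    SplitsVirtually (outProj G) := by
  classical
  obtain ⟨m, ⟨eH⟩⟩ := Finite.exists_equiv_fin H
  obtain ⟨F, _, _, π, hπ⟩ := cx_rf_finite hrf (ι := Fin m × ι)
    (fun p => ((eH.symm p.1 : H) : G) * gen p.2 * ((eH.symm p.1 : H) : G)⁻¹ * (gen p.2)⁻¹)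
  let A : Subgroup (MulAut G) :=
    { carrier := {φ | (∀ h ∈ H, φ h = h) ∧ ∀ x, π (φ x) = π x}
      one_mem' := ⟨fun _ _ => rfl, fun _ => rfl⟩
      mul_mem' := by
        rintro a b ⟨ha, ha'⟩ ⟨hb, hb'⟩
        refine ⟨fun h hh => ?_, fun x => ?_⟩
        · rw [MulAut.mul_apply, hb h hh, ha h hh]
        · rw [MulAut.mul_apply, ha', hb']
      inv_mem' := by
        rintro a ⟨ha, ha'⟩
        refine ⟨fun h hh => ?_, fun x => ?_⟩
        · conv_lhs => rw [← ha h hh]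
          exact a.symm_apply_apply h
        · rw [← ha' (a⁻¹ x)]
          congr 1
          exact a.apply_symm_apply x }
  -- the projection is injective on `A`
  have hinj : ∀ a : A, outProj G a = 1 → a = 1 := by
    rintro ⟨a, ha, ha'⟩ h1
    have h2 : a ∈ Inn G := (QuotientGroup.eq_one_iff a).1 h1
    obtain ⟨c, rfl⟩ := h2
    have hcH : c ∈ H := by
      apply hcent
      intro h hh
      have := ha h hh
      rw [MulAut.conj_apply, mul_inv_eq_iff_eq_mul] at this
      exact this
    have hcg : ∀ i, c * gen i = gen i * c := by
      intro i
      have h3 := hπ (eH ⟨c, hcH⟩, i)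
      simp only [Equiv.symm_apply_apply] at h3
      have h4 := ha' (gen i)
      rw [MulAut.conj_apply] at h4
      have h5 := h3 (by rw [map_mul, h4, ← map_mul]; simp)
      rw [mul_inv_eq_one, mul_inv_eq_iff_eq_mul] at h5
      exact h5
    have hcz : ∀ x, c * x = x * c := by
      intro x
      have hx : x ∈ Subgroup.closure (Set.range gen) := by rw [hgen]; trivial
      have hle : Subgroup.closure (Set.range gen) ≤ Subgroup.centralizer {c} := by
        rw [Subgroup.closure_le]
        rintro _ ⟨i, rfl⟩
        exact Subgroup.mem_centralizer_singleton_iff.2 (hcg i).symm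
      exact (Subgroup.mem_centralizer_singleton_iff.1 (hle hx)).symm
    ext x
    show MulAut.conj c x = x
    rw [MulAut.conj_apply, hcz]; simp
  let p : A →* Out G := (outProj G).comp A.subtype
  have hpinj : Function.Injective p := (injective_iff_map_eq_one p).2 hinj
  refine ⟨p.range, ?_, ?_⟩
  · -- finite index
    choose g hg using hconj
    have hsurj : ∀ o : Out G, ∃ φ : MulAut G, outProj G φ = o := QuotientGroup.mk'_surjective _
    choose σ hσ using hsurj
    -- normalised representative
    let ψ : Out G → MulAut G := fun o => MulAut.conj (g (σ o)) * σ o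
    have hψ : ∀ o, outProj G (ψ o) = o := by
      intro o
      rw [map_mul, hσ]
      have : outProj G (MulAut.conj (g (σ o))) = 1 :=
        (QuotientGroup.eq_one_iff _).2 ⟨_, rfl⟩
      rw [this, one_mul]
    have hψX : ∀ o, ∀ h ∈ H, ψ o h ∈ X := fun o h hh => hg (σ o) h hh
    have : Finite X := hX
    let D : Out G → (H → X) × (ι → F) := fun o =>
      (fun h => ⟨ψ o h.1, hψX o h.1 h.2⟩, fun i => π ((ψ o)⁻¹ (gen i)))
    have hD : ∀ o o', D o = D o' → o⁻¹ * o' ∈ p.range := by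
      intro o o' h
      have e1 : ∀ h ∈ H, ψ o h = ψ o' h := by
        intro x hx
        have := congrFun (congrArg Prod.fst h) ⟨x, hx⟩
        exact congrArg Subtype.val this
      have e2 : ∀ x, π ((ψ o)⁻¹ x) = π ((ψ o')⁻¹ x) := by
        have : π.comp ((ψ o)⁻¹ : MulAut G).toMonoidHom = π.comp ((ψ o')⁻¹ : MulAut G).toMonoidHom := by
          refine MonoidHom.eq_of_eqOn_dense hgen ?_
          rintro _ ⟨i, rfl⟩
          exact congrFun (congrArg Prod.snd h) i
        intro x
        exact DFunLike.congr_fun this x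
      refine ⟨⟨(ψ o)⁻¹ * ψ o', ?_, ?_⟩, ?_⟩
      · intro h hh
        rw [MulAut.mul_apply, ← e1 h hh]
        exact (ψ o).symm_apply_apply h
      · intro x
        rw [MulAut.mul_apply, e2]
        congr 1
        exact (ψ o').symm_apply_apply x
      · show outProj G ((ψ o)⁻¹ * ψ o') = _
        rw [map_mul, map_inv, hψ, hψ]
    have hq : Finite (Out G ⧸ p.range) := by
      refine Finite.of_injective (fun c : Out G ⧸ p.range => D c.out) ?_
      intro c c' h
      have h1 := hD _ _ h
      rw [← QuotientGroup.out_eq' c, ← QuotientGroup.out_eq' c']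
      exact QuotientGroup.eq.2 h1
    exact Subgroup.finiteIndex_of_finite_quotient
  · let e := MonoidHom.ofInjective hpinj
    refine ⟨A.subtype.comp e.symm.toMonoidHom, fun x => ?_⟩
    have : e (e.symm x) = x := e.apply_symm_apply x
    exact congrArg Subtype.val this

end Criterion

/-- If `G` is a finitely generated Coxeter group, then `Aut(G) → Out(G)`
splits virtually. -/
theorem statement2 (G : Type*) [Group G]
    (hcox : ∃ (B : Type) (_ : Finite B) (M : CoxeterMatrix B), Nonempty (CoxeterSystem M G)) :
    SplitsVirtually (outProj G) := by
  classical
  obtain ⟨B, _, M, ⟨cs⟩⟩ := hcox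
  have := Fintype.ofFinite B
  obtain ⟨I, hI⟩ := cx_exists_maximal cs
  have hfin : Finite (cxP cs I) := hI.prop
  refine cx_criterion cs.simple cs.subgroup_closure_range_simple (cx_residually_finite cs)
    (cxP cs I) (⋃ J ∈ {J : Set B | Finite (cxP cs J)}, (cxP cs J : Set G)) ?_ ?_
    (fun c hc => cx_centralizer cs hI c hc)
  · exact Set.Finite.biUnion (Set.toFinite _) fun J hJ => hJ
  · intro φ
    have : Finite ((cxP cs I).map φ.toMonoidHom) :=
      inferInstanceAs (Finite (((cxP cs I : Set G)).image φ))
    obtain ⟨g, J, hJ, hg⟩ := cx_tits cs ((cxP cs I).map φ.toMonoidHom)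
    refine ⟨g, fun h hh => ?_⟩
    exact Set.mem_biUnion (show J ∈ {J : Set B | Finite (cxP cs J)} from hJ)
      (hg _ ⟨h, hh, rfl⟩)
end

section
/- Let G be a finitely generated Coxeter group. Then for all but finitely many primes p, the group Out(G) is virtually residually p; that is, the set of primes p such that Out(G) has no finite-index residually p subgroup is finite. -/
/-! ### Part 1: residually `p` groups and their automorphism groups -/

universe u v w

namespace CoxOut

theorem residuallyP_of {p : ℕ} {G : Type u} [Group G]
    (h : ∀ g : G, g ≠ 1 → ∃ (F : Type v) (_ : Group F) (_ : Finite F) (φ : G →* F),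
      IsPGroup p F ∧ φ g ≠ 1) : ResiduallyP p G := by
  intro g hg
  obtain ⟨F, _, _, φ, hF, hφ⟩ := h g hg
  refine ⟨Shrink.{0} F, inferInstance, inferInstance,
    (Shrink.mulEquiv.{0} (α := F)).symm.toMonoidHom.comp φ, ?_, ?_⟩
  · exact hF.of_equiv (Shrink.mulEquiv.{0} (α := F)).symm
  · simpa using hφ

theorem residuallyP_of_injective {p : ℕ} {G : Type u} {H : Type v} [Group G] [Group H]
    (f : G →* H) (hf : Function.Injective f) (hH : ResiduallyP p H) : ResiduallyP p G := by
  intro g hg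
  obtain ⟨F, i1, i2, φ, hF, hφ⟩ := hH (f g) (fun h => hg (hf (by simpa using h)))
  exact ⟨F, i1, i2, φ.comp f, hF, hφ⟩

theorem finite_hom (N : Type u) (F : Type v) [Group N] [Group F] [Group.FG N] [Finite F] :
    Finite (N →* F) := by
  obtain ⟨S, hS, hfin⟩ := (Group.fg_iff (G := N)).1 inferInstance
  have : Finite S := hfin
  refine Finite.of_injective (fun (f : N →* F) (s : S) => f s) ?_
  intro f g hfg
  refine MonoidHom.eq_of_eqOn_dense hS ?_
  intro x hx
  exact congrFun hfg ⟨x, hx⟩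

/-- The intersection of the kernels of all homomorphisms `N → F`. -/
def charKer (N : Type u) (F : Type v) [Group N] [Group F] : Subgroup N := ⨅ f : N →* F, f.ker

theorem mem_charKer {N : Type u} {F : Type v} [Group N] [Group F] {x : N} :
    x ∈ charKer N F ↔ ∀ f : N →* F, f x = 1 := by
  simp [charKer, Subgroup.mem_iInf, MonoidHom.mem_ker]

theorem charKer_finiteIndex (N : Type u) (F : Type v) [Group N] [Group F] [Group.FG N] [Finite F] :
    (charKer N F).FiniteIndex := by
  have := finite_hom N F
  exact Subgroup.finiteIndex_iInf (fun f => inferInstance)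

theorem charKer_le_of_index {N : Type u} [Group N] {n : ℕ} (hn : n ≠ 0) (M : Subgroup N)
    (hM : M.index = n) : charKer N (Equiv.Perm (Fin n)) ≤ M := by
  have : Finite (N ⧸ M) := by
    apply Nat.finite_of_card_ne_zero
    change M.index ≠ 0
    rwa [hM]
  have e : N ⧸ M ≃ Fin n := Finite.equivFinOfCardEq hM
  intro x hx
  have h := mem_charKer.1 hx ((e.permCongrHom.toMonoidHom).comp (MulAction.toPermHom N (N ⧸ M)))
  have h2 : MulAction.toPermHom N (N ⧸ M) x = 1 := by
    refine e.permCongrHom.injective ?_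
    rw [map_one]
    exact h
  have h3 := congrArg (fun (s : Equiv.Perm (N ⧸ M)) => s ((1 : N) : N ⧸ M)) h2
  simp only [MulAction.toPermHom_apply, MulAction.toPerm_apply, Equiv.Perm.coe_one, id_eq] at h3
  change ((x * 1 : N) : N ⧸ M) = ((1 : N) : N ⧸ M) at h3
  rw [mul_one, eq_comm, QuotientGroup.eq] at h3
  simpa using h3

instance charKer_characteristic (N : Type u) (F : Type v) [Group N] [Group F] :
    (charKer N F).Characteristic := by
  rw [Subgroup.characteristic_iff_le_comap]
  intro φ x hx
  rw [Subgroup.mem_comap, mem_charKer]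
  intro f
  exact mem_charKer.1 hx (f.comp φ.toMonoidHom)

theorem characteristic_map_subtype {G : Type u} [Group G] (N : Subgroup G) [hN : N.Characteristic]
    (L : Subgroup N) [hL : L.Characteristic] : (L.map N.subtype).Characteristic := by
  rw [Subgroup.characteristic_iff_map_le]
  rintro φ _ ⟨_, ⟨l, hl, rfl⟩, rfl⟩
  have h1 := Subgroup.characteristic_iff_map_le.1 hL (MulAut.characteristic N φ)
  refine ⟨MulAut.characteristic N φ l, h1 ⟨l, hl, rfl⟩, rfl⟩

/-- The action of automorphisms on the quotient by a characteristic subgroup. -/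
def quotHom {G : Type u} [Group G] (L : Subgroup G) [hL : L.Characteristic] :
    MulAut G →* MulAut (G ⧸ L) where
  toFun φ := QuotientGroup.congr L L φ (Subgroup.characteristic_iff_map_eq.1 hL φ)
  map_one' := by
    ext x
    obtain ⟨x, rfl⟩ := QuotientGroup.mk_surjective x
    rfl
  map_mul' := by
    intro a b
    ext x
    obtain ⟨x, rfl⟩ := QuotientGroup.mk_surjective x
    rfl

@[simp] theorem quotHom_mk {G : Type u} [Group G] (L : Subgroup G) [hL : L.Characteristic]
    (φ : MulAut G) (x : G) : quotHom L φ (x : G ⧸ L) = ((φ x : G) : G ⧸ L) := rfl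

theorem isPGroup_of_trivial_mod {p : ℕ} [hp : Fact p.Prime] {Q : Type u} [Group Q] [Finite Q]
    (P Φ : Subgroup Q) (hP : IsPGroup p P) (hle : Φ ≤ P)
    (hM : ∀ M : Subgroup Q, M.relIndex P = p → Φ ≤ M)
    (A : Subgroup (MulAut Q)) (hA : ∀ α ∈ A, ∀ x : Q, x⁻¹ * α x ∈ Φ) : IsPGroup p A := by
  have hΦ : IsPGroup p Φ := hP.to_le hle
  refine IsPGroup.iff_card.2 ⟨_, Nat.eq_prime_pow_of_unique_prime_dvd Nat.card_pos.ne' ?_⟩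
  intro q hq hdvd
  by_contra hqp
  have : Fact q.Prime := ⟨hq⟩
  obtain ⟨⟨α, hαA⟩, hord⟩ := exists_prime_orderOf_dvd_card' q hdvd
  have hord' : orderOf α = q := by rw [← hord]; exact (Subgroup.orderOf_mk α hαA).symm ▸ rfl
  have hzA : ∀ β ∈ Subgroup.zpowers α, ∀ x : Q, x⁻¹ * β x ∈ Φ := fun β hβ =>
    hA β ((Subgroup.zpowers_le.2 hαA) hβ)
  have hcard : Nat.card (Subgroup.zpowers α) = q := by rw [Nat.card_zpowers, hord']
  have hq' : IsPGroup q (Subgroup.zpowers α) := IsPGroup.of_card (n := 1) (by simpa using hcard)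
  -- every coset contains a fixed point
  have hfix : ∀ x : Q, ∃ c ∈ Φ, α (x * c) = x * c := by
    intro x
    let S : SubMulAction (Subgroup.zpowers α) Q :=
      { carrier := {y | x⁻¹ * y ∈ Φ}
        smul_mem' := by
          rintro ⟨β, hβ⟩ y hy
          change x⁻¹ * β y ∈ Φ
          have := Φ.mul_mem hy (hzA β hβ y)
          simpa [mul_assoc] using this }
    have e : S ≃ Φ :=
      { toFun := fun y => ⟨x⁻¹ * y.1, y.2⟩
        invFun := fun c => ⟨x * c.1, by change x⁻¹ * (x * c.1) ∈ Φ; simp⟩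
        left_inv := fun y => by simp
        right_inv := fun c => by simp }
    have hndvd : ¬ q ∣ Nat.card S := by
      rw [Nat.card_congr e]
      obtain ⟨n, hn⟩ := IsPGroup.iff_card.1 hΦ
      rw [hn]
      intro h
      exact hqp ((Nat.prime_dvd_prime_iff_eq hq hp.out).1 (hq.dvd_of_dvd_pow h))
    obtain ⟨y, hy⟩ := hq'.nonempty_fixed_point_of_prime_not_dvd_card S hndvd
    refine ⟨x⁻¹ * y.1, y.2, ?_⟩
    have := hy ⟨α, Subgroup.mem_zpowers α⟩
    have h2 : α y.1 = y.1 := congrArg Subtype.val this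
    simpa using h2
  let F : Subgroup Q :=
    { carrier := {x | α x = x}
      one_mem' := map_one α
      mul_mem' := by
        intro a b ha hb
        change α (a * b) = a * b
        rw [map_mul, ha, hb]
      inv_mem' := by
        intro a ha
        change α a⁻¹ = a⁻¹
        rw [map_inv, ha] }
  have hPF : P ≤ F := by
    by_contra hcon
    obtain ⟨a, ha⟩ := IsPGroup.iff_card.1 hP
    obtain ⟨b, hb⟩ := IsPGroup.iff_card.1 (hP.to_subgroup (F.subgroupOf P))
    have hlt : b < a := by
      have hbd : Nat.card (F.subgroupOf P) ∣ Nat.card P := Subgroup.card_subgroup_dvd_card _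
      rw [ha, hb] at hbd
      have h1 := (Nat.pow_dvd_pow_iff_le_right hp.out.one_lt).1 hbd
      rcases h1.lt_or_eq with h | h
      · exact h
      · exfalso
        apply hcon
        rw [← Subgroup.subgroupOf_eq_top]
        apply Subgroup.eq_top_of_card_eq
        rw [ha, hb, h]
    obtain ⟨M, hMc, hMle⟩ := Sylow.exists_subgroup_card_pow_prime_le (G := P) p (n := b) (m := a - 1)
      (by rw [ha]; exact pow_dvd_pow p (Nat.sub_le a 1)) (F.subgroupOf P) hb (by omega)
    have hMi : M.index = p := by
      have h1 := M.card_mul_index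
      rw [hMc, ha] at h1
      have h2 : p ^ a = p ^ (a - 1) * p := by rw [← pow_succ]; congr 1; omega
      rw [h2] at h1
      exact Nat.eq_of_mul_eq_mul_left (pow_pos hp.out.pos _) h1
    have hΦM : Φ ≤ M.map P.subtype := by
      apply hM
      rw [Subgroup.relIndex, Subgroup.subgroupOf, Subgroup.comap_map_eq_self_of_injective
        P.subtype_injective, hMi]
    have htop : M = ⊤ := by
      rw [eq_top_iff]
      rintro ⟨x, hx⟩ -
      obtain ⟨c, hc, hfc⟩ := hfix x
      have h1 : (⟨x * c, P.mul_mem hx (hle hc)⟩ : P) ∈ M := hMle (by exact hfc)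
      obtain ⟨c', hc', hcc⟩ := hΦM hc
      have h2 : (⟨x, hx⟩ : P) = ⟨x * c, P.mul_mem hx (hle hc)⟩ * c'⁻¹ := by
        apply Subtype.ext
        simp only [Subgroup.coe_mul, Subgroup.coe_inv]
        rw [← hcc]
        simp
      rw [h2]
      exact M.mul_mem h1 (M.inv_mem hc')
    rw [htop, Subgroup.index_top] at hMi
    exact hp.out.one_lt.ne hMi
  have hα : α = 1 := by
    ext x
    obtain ⟨c, hc, hfc⟩ := hfix x
    have h1 : α c = c := hPF (hle hc)
    rw [map_mul, h1] at hfc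
    simpa using hfc
  rw [hα, orderOf_one] at hord'
  exact hq.one_lt.ne hord'

/-- If `G` is finitely generated and virtually residually `p`, so is `Aut G`. -/
theorem virtuallyResiduallyP_mulAut {p : ℕ} [hp : Fact p.Prime] (G : Type u) [Group G]
    [Group.FG G] (h : VirtuallyResiduallyP p G) : VirtuallyResiduallyP p (MulAut G) := by
  obtain ⟨K, hK, hKp⟩ := h
  have hN : ∃ N : Subgroup G, N.Characteristic ∧ N.FiniteIndex ∧ N ≤ K :=
    ⟨charKer G (Equiv.Perm (Fin K.index)), inferInstance, charKer_finiteIndex _ _,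
      charKer_le_of_index hK.index_ne_zero K rfl⟩
  obtain ⟨N, hNc, hNf, hNK⟩ := hN
  have hNp : ResiduallyP p N :=
    residuallyP_of_injective (Subgroup.inclusion hNK) (Subgroup.inclusion_injective hNK) hKp
  have hfin : ∀ L : Subgroup N, L.FiniteIndex → (L.map N.subtype).FiniteIndex := by
    intro L hL
    constructor
    rw [Subgroup.index_map_subtype]
    exact mul_ne_zero hL.index_ne_zero hNf.index_ne_zero
  set N0 : Subgroup N := charKer N (Equiv.Perm (Fin p)) with hN0
  have hc0 : (N0.map N.subtype).Characteristic := characteristic_map_subtype N N0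
  have hf0 : (N0.map N.subtype).FiniteIndex := hfin _ (charKer_finiteIndex _ _)
  refine ⟨(quotHom (N0.map N.subtype)).ker, inferInstance, residuallyP_of ?_⟩
  rintro ⟨φ, hφ⟩ hφ1
  have hΓ : ∀ ψ ∈ (quotHom (N0.map N.subtype)).ker, ∀ x, x⁻¹ * ψ x ∈ N0.map N.subtype := by
    intro ψ hψ x
    rw [MonoidHom.mem_ker] at hψ
    have h1 : quotHom (N0.map N.subtype) ψ (x : G ⧸ _) = (x : G ⧸ _) := by rw [hψ]; rfl
    rw [quotHom_mk, eq_comm, QuotientGroup.eq] at h1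
    exact h1
  have hne : ∃ g, φ g ≠ g := by
    by_contra hcon
    push Not at hcon
    exact hφ1 (Subtype.ext (MulEquiv.ext hcon))
  obtain ⟨g, hg⟩ := hne
  obtain ⟨n, -, hn⟩ := hΓ φ hφ g
  have hn1 : n ≠ 1 := by
    rintro rfl
    apply hg
    have : g⁻¹ * φ g = 1 := by rw [← hn]; rfl
    exact (inv_mul_eq_one.1 this).symm
  obtain ⟨F, _, _, f, hF, hfn⟩ := hNp n hn1
  set L : Subgroup N := charKer N F with hL
  have hcL : (L.map N.subtype).Characteristic := characteristic_map_subtype N L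
  have hfL : (L.map N.subtype).FiniteIndex := hfin _ (charKer_finiteIndex _ _)
  have : Finite (G ⧸ L.map N.subtype) := inferInstance
  let r : N →* G ⧸ L.map N.subtype := (QuotientGroup.mk' _).comp N.subtype
  have hA : IsPGroup p ((quotHom (N0.map N.subtype)).ker.map (quotHom (L.map N.subtype))) := by
    refine isPGroup_of_trivial_mod r.range (N0.map r) ?_ ?_ ?_ _ ?_
    · obtain ⟨k, hk⟩ := IsPGroup.iff_card.1 hF
      rintro ⟨_, m, rfl⟩
      refine ⟨k, Subtype.ext ?_⟩
      change (r m) ^ p ^ k = 1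
      rw [← map_pow]
      change (QuotientGroup.mk (N.subtype (m ^ p ^ k)) : G ⧸ L.map N.subtype) = 1
      rw [QuotientGroup.eq_one_iff]
      refine ⟨m ^ p ^ k, mem_charKer.2 (fun f => ?_), rfl⟩
      rw [map_pow, ← hk, pow_card_eq_one']
    · rintro _ ⟨x, -, rfl⟩
      exact ⟨x, rfl⟩
    · intro M hM
      rw [Subgroup.map_le_iff_le_comap]
      refine charKer_le_of_index hp.out.ne_zero _ ?_
      rw [Subgroup.index_comap, hM]
    · rintro _ ⟨ψ, hψ, rfl⟩ x
      obtain ⟨x, rfl⟩ := QuotientGroup.mk_surjective x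
      obtain ⟨m, hm, hmx⟩ := hΓ ψ hψ x
      refine ⟨m, hm, ?_⟩
      change (QuotientGroup.mk (N.subtype m) : G ⧸ L.map N.subtype) = _
      rw [hmx]
      rfl
  refine ⟨_, inferInstance, inferInstance,
    (quotHom (L.map N.subtype)).subgroupMap _, hA, ?_⟩
  intro hcon
  have h1 : quotHom (L.map N.subtype) φ = 1 := congrArg Subtype.val hcon
  have h2 : quotHom (L.map N.subtype) φ (g : G ⧸ _) = (g : G ⧸ _) := by rw [h1]; rfl
  rw [quotHom_mk, eq_comm, QuotientGroup.eq, ← hn] at h2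
  obtain ⟨n', hn', hnn⟩ := h2
  have : n' = n := N.subtype_injective hnn
  subst this
  exact hfn (mem_charKer.1 hn' f)

end CoxOut
/-! ### Part 2: from `Aut G` to `Out G` -/

namespace CoxOut

theorem virtuallyResiduallyP_out {p : ℕ} (G : Type u) [Group G] (H : Subgroup G)
    (hC : (Subgroup.centralizer (H : Set G) : Set G).Finite)
    (E : Set (H → G)) (hE : E.Finite)
    (hEH : ∀ φ : MulAut G, ∃ e ∈ E, ∃ g : G, ∀ h : H, φ h = g * e h * g⁻¹)
    (hAut : VirtuallyResiduallyP p (MulAut G)) : VirtuallyResiduallyP p (Out G) := by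
  obtain ⟨Γ, hΓ, hΓp⟩ := hAut
  -- a finite-index subgroup avoiding the nontrivial inner automorphisms fixing `H`
  have hker : ({φ : MulAut G | φ ∈ Γ ∧ φ ∈ autFix G H ∧ φ ∈ Inn G ∧ φ ≠ 1}).Finite := by
    refine (hC.image (fun g => MulAut.conj g)).subset ?_
    rintro φ ⟨-, h1, ⟨g, rfl⟩, -⟩
    refine ⟨g, ?_, rfl⟩
    intro h hh
    have := h1 h hh
    rw [MulAut.conj_apply] at this
    exact (mul_inv_eq_iff_eq_mul.1 this).symm
  have hav : ∀ φ : {φ : MulAut G | φ ∈ Γ ∧ φ ∈ autFix G H ∧ φ ∈ Inn G ∧ φ ≠ 1},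
      ∃ Δ : Subgroup Γ, Δ.FiniteIndex ∧ ∀ x ∈ Δ, (x : MulAut G) ≠ φ := by
    rintro ⟨φ, h1, h2, h3, h4⟩
    obtain ⟨F, _, _, f, hF, hf⟩ := hΓp ⟨φ, h1⟩ (fun h => h4 (congrArg Subtype.val h))
    refine ⟨f.ker, inferInstance, ?_⟩
    rintro x hx rfl
    exact hf hx
  choose Δ hΔf hΔ using hav
  have : Finite {φ : MulAut G | φ ∈ Γ ∧ φ ∈ autFix G H ∧ φ ∈ Inn G ∧ φ ≠ 1} := hker
  have hD : (⨅ φ, Δ φ).FiniteIndex := Subgroup.finiteIndex_iInf hΔf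
  set Γ' : Subgroup (MulAut G) := (⨅ φ, Δ φ).map Γ.subtype with hΓ'
  have hΓ'f : Γ'.FiniteIndex := by
    constructor
    rw [hΓ', Subgroup.index_map_subtype]
    exact mul_ne_zero hD.index_ne_zero hΓ.index_ne_zero
  have hle : Γ' ≤ Γ := Subgroup.map_subtype_le _
  have htriv : ∀ φ ∈ Γ' ⊓ autFix G H, φ ∈ Inn G → φ = 1 := by
    rintro φ ⟨h1, h2⟩ h3
    by_contra h4
    obtain ⟨x, hx, rfl⟩ := h1
    have h5 := hΔ ⟨_, x.2, h2, h3, h4⟩ x (Subgroup.mem_iInf.1 hx _)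
    exact h5 rfl
  have hindex : ((autFix G H).map (outProj G)).FiniteIndex := by
    have : Finite E := hE
    choose e he g hg using hEH
    have hs : Function.Surjective (outProj G) := QuotientGroup.mk'_surjective _
    choose σ hσ using hs
    have : Function.Injective (fun q : Out G ⧸ ((autFix G H).map (outProj G)) =>
        (⟨e (σ q.out), he _⟩ : E)) := by
      intro q r hqr
      have h1 : e (σ q.out) = e (σ r.out) := congrArg Subtype.val hqr
      rw [← QuotientGroup.out_eq' q, ← QuotientGroup.out_eq' r, QuotientGroup.eq]
      set a := σ q.out
      set b := σ r.out
      rw [← hσ q.out, ← hσ r.out]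
      change (outProj G a)⁻¹ * outProj G b ∈ _
      -- `a⁻¹ * conj k * b` fixes `H`
      refine ⟨a⁻¹ * MulAut.conj (g a * (g b)⁻¹) * b, ?_, ?_⟩
      · intro h hh
        have hb := hg b ⟨h, hh⟩
        have ha := hg a ⟨h, hh⟩
        simp only at hb ha
        change a⁻¹ ((g a * (g b)⁻¹) * b h * (g a * (g b)⁻¹)⁻¹) = h
        have h2 : (g a * (g b)⁻¹) * b h * (g a * (g b)⁻¹)⁻¹ = a h := by
          rw [hb, ha, h1]; group
        rw [h2]
        exact a.symm_apply_apply h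
      · rw [map_mul, map_mul, map_inv]
        have h3 : outProj G (MulAut.conj (g a * (g b)⁻¹)) = 1 :=
          (QuotientGroup.eq_one_iff (N := Inn G) _).2 ⟨_, rfl⟩
        rw [h3, mul_one]
    have := Finite.of_injective _ this
    exact Subgroup.finiteIndex_of_finite_quotient
  refine ⟨(Γ' ⊓ autFix G H).map (outProj G), ?_, ?_⟩
  · -- finite index
    constructor
    have h1 : ((Γ' ⊓ autFix G H).map (outProj G)).relIndex ((autFix G H).map (outProj G)) ≠ 0 := by
      have h2 : (Γ' ⊓ autFix G H).relIndex (autFix G H) ≠ 0 := by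
        rw [Subgroup.inf_relIndex_right]
        exact (inferInstance : (Γ'.subgroupOf (autFix G H)).FiniteIndex).index_ne_zero
      rw [← Subgroup.relIndex_comap]
      exact fun h0 => h2 (Subgroup.relIndex_eq_zero_of_le_left (Subgroup.le_comap_map _ _) h0)
    rw [← Subgroup.relIndex_mul_index (Subgroup.map_mono inf_le_right)]
    exact mul_ne_zero h1 hindex.index_ne_zero
  · -- residually p
    have hinj : Function.Injective ((outProj G).subgroupMap (Γ' ⊓ autFix G H)) := by
      rw [injective_iff_map_eq_one]
      intro x hx
      have h1 : outProj G x = 1 := congrArg Subtype.val hx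
      have h2 : (x : MulAut G) ∈ Inn G := (QuotientGroup.eq_one_iff (N := Inn G) _).1 h1
      exact Subtype.ext (htriv x x.2 h2)
    let eq := MulEquiv.ofBijective _ ⟨hinj, (outProj G).subgroupMap_surjective (Γ' ⊓ autFix G H)⟩
    refine residuallyP_of_injective eq.symm.toMonoidHom eq.symm.injective ?_
    have hle2 : Γ' ⊓ autFix G H ≤ Γ := inf_le_left.trans hle
    exact residuallyP_of_injective (Subgroup.inclusion hle2) (Subgroup.inclusion_injective hle2) hΓp

end CoxOut
/-! ### Part 3: groups of integer matrices are virtually residually `p` -/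

namespace CoxOut

theorem exists_pow_eq_of_eq_one_add {R : Type u} [Ring R] (p k : ℕ) (y : R) :
    ∃ z : R, (1 + (p : R) * y) ^ p ^ k = 1 + ((p ^ (k + 1) : ℕ) : R) * z := by
  have h : ((p : ℕ) : Polynomial ℤ) ∣ (1 + (p : Polynomial ℤ) * Polynomial.X) - 1 := by simp
  obtain ⟨q, hq⟩ := dvd_sub_pow_of_dvd_sub h k
  refine ⟨Polynomial.aeval y q, ?_⟩
  have h2 := congrArg (Polynomial.aeval y) hq
  simp only [map_sub, map_pow, map_add, map_mul, map_one, map_natCast, Polynomial.aeval_X,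
    one_pow] at h2
  rw [sub_eq_iff_eq_add'] at h2
  rw [h2]
  push_cast
  rfl

theorem virtuallyResiduallyP_of_matrix {p : ℕ} [hp : Fact p.Prime] (G : Type u) [Group G] (n : ℕ)
    (ρ : G →* Matrix (Fin n) (Fin n) ℤ) (hρ : Function.Injective ρ) :
    VirtuallyResiduallyP p G := by
  let red : ∀ k : ℕ, Matrix (Fin n) (Fin n) ℤ →+* Matrix (Fin n) (Fin n) (ZMod (p ^ k)) :=
    fun k => (Int.castRingHom (ZMod (p ^ k))).mapMatrix
  let f : ∀ k : ℕ, G →* (Matrix (Fin n) (Fin n) (ZMod (p ^ k)))ˣ :=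
    fun k => ((red k).toMonoidHom.comp ρ).toHomUnits
  have hf : ∀ k g, ((f k g : (Matrix (Fin n) (Fin n) (ZMod (p ^ k)))ˣ) : Matrix _ _ _)
    = red k (ρ g) := fun k g => rfl
  have hne : ∀ k, NeZero (p ^ k) := fun k => ⟨pow_ne_zero _ hp.out.ne_zero⟩
  have hfin : ∀ k, Finite (Matrix (Fin n) (Fin n) (ZMod (p ^ k))) := fun k => by
    have := hne k
    infer_instance
  have hred : ∀ k (A : Matrix (Fin n) (Fin n) ℤ), red k A = 1 ↔
      ∃ Y, A = 1 + ((p ^ k : ℕ) : Matrix (Fin n) (Fin n) ℤ) * Y := by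
    intro k A
    have hz : red k ((p ^ k : ℕ) : Matrix (Fin n) (Fin n) ℤ) = 0 := by
      rw [map_natCast]
      rw [← Matrix.diagonal_natCast]
      simp
    constructor
    · intro h
      have h1 : ∀ i j, ((p ^ k : ℕ) : ℤ) ∣ (A - 1) i j := by
        intro i j
        rw [← ZMod.intCast_zmod_eq_zero_iff_dvd]
        have h2 : red k (A - 1) = 0 := by rw [map_sub, map_one, h, sub_self]
        exact congrFun (congrFun h2 i) j
      choose Y hY using h1
      refine ⟨Matrix.of Y, ?_⟩
      rw [← sub_eq_iff_eq_add']
      ext i j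
      rw [hY i j, ← Matrix.diagonal_natCast, Matrix.diagonal_mul]
      rfl
    · rintro ⟨Y, rfl⟩
      rw [map_add, map_mul, hz, map_one, zero_mul, add_zero]
  refine ⟨(f 1).ker, ?_, residuallyP_of ?_⟩
  · have := hfin 1
    infer_instance
  rintro ⟨g, hg⟩ hg1
  have hg2 : ρ g - 1 ≠ 0 := by
    intro h
    apply hg1
    apply Subtype.ext
    apply hρ
    rw [sub_eq_zero] at h
    rw [h]
    simp
  obtain ⟨i, j, hij⟩ : ∃ i j, (ρ g - 1) i j ≠ 0 := by
    by_contra hcon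
    push Not at hcon
    exact hg2 (by ext i j; exact hcon i j)
  obtain ⟨k, hk⟩ : ∃ k : ℕ, ¬ ((p ^ k : ℕ) : ℤ) ∣ (ρ g - 1) i j := by
    refine ⟨((ρ g - 1) i j).natAbs, fun h => ?_⟩
    have h1 := Int.natAbs_dvd_natAbs.2 h
    rw [Int.natAbs_natCast] at h1
    have h2 := Nat.le_of_dvd (Int.natAbs_pos.2 hij) h1
    exact absurd h2 (not_le.2 (Nat.lt_pow_self hp.out.one_lt))
  have := hfin k
  refine ⟨(f 1).ker.map (f k), inferInstance, inferInstance, (f k).subgroupMap _, ?_, ?_⟩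
  · rintro ⟨_, x, hx, rfl⟩
    refine ⟨k, Subtype.ext ?_⟩
    change (f k x) ^ p ^ k = 1
    rw [← map_pow]
    apply Units.ext
    rw [hf, map_pow, Units.val_one, hred]
    have h1 : red 1 (ρ x) = 1 := by
      rw [← hf]
      exact congrArg Units.val hx
    obtain ⟨Y, hY⟩ := (hred 1 _).1 h1
    rw [pow_one] at hY
    obtain ⟨z, hz⟩ := exists_pow_eq_of_eq_one_add p k Y
    refine ⟨(p : Matrix (Fin n) (Fin n) ℤ) * z, ?_⟩
    rw [hY, hz, ← mul_assoc, pow_succ]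
    push_cast
    rfl
  · intro hcon
    have h1 : f k g = 1 := congrArg Subtype.val hcon
    have h2 : red k (ρ g) = 1 := by rw [← hf, h1]; rfl
    obtain ⟨Y, hY⟩ := (hred k _).1 h2
    apply hk
    rw [hY, add_sub_cancel_left, ← Matrix.diagonal_natCast, Matrix.diagonal_mul]
    exact dvd_mul_right _ _

/-- A group acting faithfully on a finitely generated torsion-free abelian group. -/
theorem virtuallyResiduallyP_of_lattice {p : ℕ} [hp : Fact p.Prime] (G : Type u) [Group G]
    (Λ : Type v) [AddCommGroup Λ] [Module.Finite ℤ Λ] [Module.Free ℤ Λ]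
    (ρ : G →* Module.End ℤ Λ) (hρ : Function.Injective ρ) :
    VirtuallyResiduallyP p G := by
  let b := Module.finBasis ℤ Λ
  let e := LinearMap.toMatrixAlgEquiv b
  exact virtuallyResiduallyP_of_matrix G _
    (e.toRingEquiv.toMulEquiv.toMonoidHom.comp ρ) (e.injective.comp hρ)

end CoxOut
/-! ### Part 4: the geometric representation of a Coxeter group -/

namespace CoxOut

section Geom

set_option linter.unusedSectionVars false

open Real

variable {B : Type} [Fintype B] [DecidableEq B] (M : CoxeterMatrix B)

/-- The numbers `2 cos (π / m)`. -/
noncomputable def cc (i j : B) : ℝ := 2 * cos (π / (M i j : ℝ))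

theorem cc_self (i : B) : cc M i i = -2 := by simp [cc]

theorem cc_symm (i j : B) : cc M i j = cc M j i := by rw [cc, cc, M.symmetric]

/-- The simple root. -/
def sr (i : B) : B → ℝ := Pi.single i 1

/-- The simple coroot. -/
noncomputable def coroot (i : B) : Module.Dual ℝ (B → ℝ) :=
  -∑ j, cc M i j • (LinearMap.proj j : (B → ℝ) →ₗ[ℝ] ℝ)

theorem coroot_apply (i : B) (v : B → ℝ) : coroot M i v = -∑ j, cc M i j * v j := by
  simp [coroot]

theorem coroot_sr (i j : B) : coroot M i (sr j) = -cc M i j := by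
  simp [coroot_apply, sr, Pi.single_apply]

theorem coroot_sr_self (i : B) : coroot M i (sr i) = 2 := by
  rw [coroot_sr, cc_self, neg_neg]

/-- The simple reflections. -/
noncomputable def rf (i : B) : (B → ℝ) ≃ₗ[ℝ] (B → ℝ) := Module.reflection (coroot_sr_self M i)

theorem rf_apply (i : B) (v : B → ℝ) : rf M i v = v - coroot M i v • sr i :=
  Module.reflection_apply _ _

theorem angle_pos {m : ℕ} (h0 : m ≠ 0) : 0 < π / (m : ℝ) :=
  div_pos pi_pos (by exact_mod_cast Nat.pos_of_ne_zero h0)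

theorem angle_lt {m : ℕ} (h2 : 2 ≤ m) : π / (m : ℝ) < π := by
  have : (2 : ℝ) ≤ m := by exact_mod_cast h2
  exact div_lt_self pi_pos (by linarith)

theorem rf_pow (i j : B) : (rf M i * rf M j) ^ M i j = 1 := by
  by_cases hij : i = j
  · subst hij
    rw [M.diagonal, pow_one]
    ext1 v
    simp only [LinearEquiv.mul_apply, LinearEquiv.coe_one, id_eq]
    exact Module.involutive_reflection (coroot_sr_self M i) v
  by_cases h0 : M i j = 0
  · rw [h0, pow_zero]
  have h1 : M i j ≠ 1 := M.off_diagonal i j hij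
  by_cases h2 : M i j = 2
  · have hc : cc M i j = 0 := by simp [cc, h2]
    have hc' : cc M j i = 0 := by rw [cc_symm, hc]
    rw [h2]
    ext1 v
    simp only [pow_two, LinearEquiv.mul_apply, LinearEquiv.coe_one, id_eq, rf_apply, map_sub,
      map_smul, coroot_sr_self, coroot_sr, hc, hc']
    module
  have h3 : 3 ≤ M i j := by omega
  set θ : ℝ := π / (M i j : ℝ) with hθ
  have hmθ : (M i j : ℝ) * θ = π := by
    rw [hθ]; field_simp
  have h3' : (3 : ℝ) ≤ (M i j : ℝ) := by exact_mod_cast h3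
  have hθ0 : 0 < θ := angle_pos h0
  have hs : sin (2 * θ) ≠ 0 := by
    apply ne_of_gt
    apply sin_pos_of_pos_of_lt_pi (by linarith)
    nlinarith
  have ht : 2 * cos (2 * θ) = coroot M i (sr j) * coroot M j (sr i) - 2 := by
    rw [coroot_sr, coroot_sr, cc_symm M j i, cc, cos_two_mul]
    ring
  ext1 v
  have key := Module.reflection_mul_reflection_pow_apply (coroot_sr_self M i) (coroot_sr_self M j)
    (M i j) v (2 * cos (2 * θ)) ht
  change ((rf M i * rf M j) ^ M i j) v = _ at key
  rw [key]
  have hS := Polynomial.Chebyshev.S_two_mul_real_cos (2 * θ)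
  rcases Nat.even_or_odd' (M i j) with ⟨k, hk | hk⟩
  · have e1 : ((M i j : ℤ) - 2) / 2 = k - 1 := by omega
    have e2 : ((M i j : ℤ) - 1) / 2 = k - 1 := by omega
    have hz : Polynomial.eval (2 * cos (2 * θ)) (Polynomial.Chebyshev.S ℝ ((k : ℤ) - 1)) = 0 := by
      have := hS ((k : ℤ) - 1)
      have h4 : (((((k : ℤ) - 1 : ℤ) : ℝ)) + 1) * (2 * θ) = π := by
        rw [← hmθ, hk]; push_cast; ring
      rw [h4, sin_pi] at this
      exact (mul_eq_zero.1 this).resolve_right hs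
    rw [e1, e2, hz]
    simp
  · have e1 : ((M i j : ℤ) - 2) / 2 = k - 1 := by omega
    have e2 : ((M i j : ℤ) - 1) / 2 = k := by omega
    have e3 : ((M i j : ℤ) - 3) / 2 = k - 1 := by omega
    have e4 : (M i j : ℤ) / 2 = k := by omega
    have hz : Polynomial.eval (2 * cos (2 * θ)) (Polynomial.Chebyshev.S ℝ (k : ℤ)) +
        Polynomial.eval (2 * cos (2 * θ)) (Polynomial.Chebyshev.S ℝ ((k : ℤ) - 1)) = 0 := by
      have a1 := hS ((k : ℤ) - 1)
      have a2 := hS (k : ℤ)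
      have h4 : (((((k : ℤ) - 1 : ℤ) : ℝ)) + 1) * (2 * θ) = π - θ := by
        rw [← hmθ, hk]; push_cast; ring
      have h5 : ((((k : ℤ) : ℝ)) + 1) * (2 * θ) = π + θ := by
        rw [← hmθ, hk]; push_cast; ring
      rw [h4, sin_pi_sub] at a1
      rw [h5, add_comm, sin_add_pi] at a2
      have : (Polynomial.eval (2 * cos (2 * θ)) (Polynomial.Chebyshev.S ℝ (k : ℤ)) +
        Polynomial.eval (2 * cos (2 * θ)) (Polynomial.Chebyshev.S ℝ ((k : ℤ) - 1))) * sin (2 * θ)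
          = 0 := by rw [add_mul, a1, a2]; ring
      exact (mul_eq_zero.1 this).resolve_right hs
    rw [e1, e2, e3, e4, hz]
    simp

variable {M} {W : Type u} [Group W] (cs : CoxeterSystem M W)

/-- The geometric representation. -/
noncomputable def geom : W →* ((B → ℝ) ≃ₗ[ℝ] (B → ℝ)) := cs.lift ⟨rf M, rf_pow M⟩

theorem geom_simple (i : B) : geom cs (cs.simple i) = rf M i := cs.lift_apply_simple _ i

theorem geom_simple_apply (i : B) (v : B → ℝ) :
    geom cs (cs.simple i) v = v - coroot M i v • sr i := by rw [geom_simple, rf_apply]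

theorem geom_mul (w w' : W) (v : B → ℝ) : geom cs (w * w') v = geom cs w (geom cs w' v) := by
  rw [map_mul]; rfl

theorem geom_simple_sr (i : B) : geom cs (cs.simple i) (sr i) = - sr i := by
  rw [geom_simple_apply, coroot_sr_self]; module

theorem S_nonneg {i j : B} (hij : i ≠ j) (k : ℕ) (hk : M i j = 0 ∨ k ≤ M i j) :
    0 ≤ Polynomial.eval (cc M i j) (Polynomial.Chebyshev.S ℝ ((k : ℤ) - 1)) := by
  by_cases h0 : M i j = 0
  · have : cc M i j = 2 := by simp [cc, h0]
    rw [this, Polynomial.Chebyshev.S_eval_two]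
    push_cast
    simp
  · have h1 : M i j ≠ 1 := M.off_diagonal i j hij
    have hk' : k ≤ M i j := hk.resolve_left h0
    have hpos := angle_pos h0
    have hs : 0 < sin (π / (M i j : ℝ)) := sin_pos_of_pos_of_lt_pi hpos (angle_lt (by omega))
    have h := Polynomial.Chebyshev.S_two_mul_real_cos (π / (M i j : ℝ)) ((k : ℤ) - 1)
    have h2 : 0 ≤ sin (((((k : ℤ) - 1 : ℤ) : ℝ) + 1) * (π / (M i j : ℝ))) := by
      apply sin_nonneg_of_nonneg_of_le_pi
      · push_cast
        rw [sub_add_cancel]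
        positivity
      · push_cast
        rw [sub_add_cancel]
        have h3 : (k : ℝ) ≤ M i j := by exact_mod_cast hk'
        calc (k : ℝ) * (π / (M i j : ℝ)) ≤ (M i j : ℝ) * (π / (M i j : ℝ)) :=
              mul_le_mul_of_nonneg_right h3 hpos.le
          _ = π := by field_simp
    rw [← h] at h2
    exact nonneg_of_mul_nonneg_left h2 hs

/-- The action of alternating words on a simple root. -/
theorem geom_alternating (i j : B) (k : ℕ) :
    geom cs (cs.wordProd (CoxeterSystem.alternatingWord i j k)) (sr i) =
      Polynomial.eval (cc M i j) (Polynomial.Chebyshev.S ℝ (((k + 1 : ℕ) : ℤ) - 1)) •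
        sr (if Even k then i else j) +
      Polynomial.eval (cc M i j) (Polynomial.Chebyshev.S ℝ ((k : ℤ) - 1)) •
        sr (if Even k then j else i) := by
  induction k with
  | zero => simp [CoxeterSystem.alternatingWord]
  | succ k ih =>
    rw [CoxeterSystem.alternatingWord_succ', cs.wordProd_cons, geom_mul, ih]
    have hS : Polynomial.eval (cc M i j) (Polynomial.Chebyshev.S ℝ (((k + 1 + 1 : ℕ) : ℤ) - 1)) =
        cc M i j * Polynomial.eval (cc M i j) (Polynomial.Chebyshev.S ℝ (((k + 1 : ℕ) : ℤ) - 1)) -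
        Polynomial.eval (cc M i j) (Polynomial.Chebyshev.S ℝ ((k : ℤ) - 1)) := by
      have h1 : (((k + 1 + 1 : ℕ) : ℤ) - 1) = ((k : ℤ) - 1) + 2 := by push_cast; ring
      have h2 : (((k + 1 : ℕ) : ℤ) - 1) = ((k : ℤ) - 1) + 1 := by push_cast; ring
      rw [h1, h2, Polynomial.Chebyshev.S_add_two]
      simp
    rw [hS]
    by_cases he : Even k
    · have ho : ¬ Even (k + 1) := by rw [Nat.even_add_one]; simpa using he
      simp only [he, ho, if_true, if_false]
      rw [map_add, map_smul, map_smul, geom_simple_sr, geom_simple_apply, coroot_sr, cc_symm M j i]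
      module
    · have ho : Even (k + 1) := by rw [Nat.even_add_one]; exact he
      simp only [he, ho, if_true, if_false]
      rw [map_add, map_smul, map_smul, geom_simple_sr, geom_simple_apply, coroot_sr]
      module

/-- Key positivity theorem. -/
theorem geom_nonneg (w : W) (i : B) (hw : ¬ cs.IsRightDescent w i) (b : B) :
    0 ≤ geom cs w (sr i) b := by
  induction hn : cs.length w using Nat.strong_induction_on generalizing w i b with
  | _ n ih =>
  subst hn
  have hsr : ∀ i b : B, (0 : ℝ) ≤ sr i b := by
    intro i b
    rw [sr, Pi.single_apply]
    split_ifs <;> norm_num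
  by_cases hw1 : w = 1
  · subst hw1
    simpa using hsr i b
  obtain ⟨j, hj⟩ := cs.exists_rightDescent_of_ne_one hw1
  have hij : i ≠ j := by rintro rfl; exact hw hj
  let Q : ℕ → Prop := fun k => ∃ v : W,
    w = v * cs.wordProd (CoxeterSystem.alternatingWord i j k) ∧ cs.length w = cs.length v + k
  have hQ1 : Q 1 := by
    refine ⟨w * cs.simple j, ?_, ?_⟩
    · simp [CoxeterSystem.alternatingWord]
    · exact (cs.isRightDescent_iff.1 hj).symm
  obtain ⟨k, hk1, ⟨v, hv, hlv⟩, hk2⟩ : ∃ k, 1 ≤ k ∧ Q k ∧ ¬ Q (k + 1) := by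
    by_contra hcon
    push Not at hcon
    have hall : ∀ k, Q (k + 1) := by
      intro k
      induction k with
      | zero => exact hQ1
      | succ k ihk => exact hcon (k + 1) (by omega) ihk
    obtain ⟨v, -, h⟩ := hall (cs.length w)
    omega
  have hx : ¬ cs.IsRightDescent v (if Even k then j else i) := by
    intro hd
    apply hk2
    refine ⟨v * cs.simple (if Even k then j else i), ?_, ?_⟩
    · rw [CoxeterSystem.alternatingWord_succ', cs.wordProd_cons, mul_assoc,
        cs.simple_mul_simple_cancel_left, ← hv]
    · have := cs.isRightDescent_iff.1 hd
      omega
  have hy : ¬ cs.IsRightDescent v (if Even k then i else j) := by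
    intro hd
    obtain ⟨l, rfl⟩ : ∃ l, k = l + 1 := ⟨k - 1, by omega⟩
    have hw2 : w = v * cs.simple (if Even (l + 1) then i else j) *
        cs.wordProd (CoxeterSystem.alternatingWord i j l) := by
      rw [hv, CoxeterSystem.alternatingWord_succ', cs.wordProd_cons, mul_assoc]
      congr 3
      by_cases he : Even l <;> simp [he, Nat.even_add_one]
    have h1 := cs.isRightDescent_iff.1 hd
    have h2 := cs.length_mul_le (v * cs.simple (if Even (l + 1) then i else j))
      (cs.wordProd (CoxeterSystem.alternatingWord i j l))
    rw [← hw2] at h2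
    have h3 := cs.length_wordProd_le (CoxeterSystem.alternatingWord i j l)
    rw [CoxeterSystem.length_alternatingWord] at h3
    omega
  have hlt : cs.length v < cs.length w := by omega
  have hkM : M i j = 0 ∨ k + 1 ≤ M i j := by
    by_contra hcon
    push Not at hcon
    obtain ⟨h0, hlt2⟩ := hcon
    have h0' : M j i ≠ 0 := by rwa [M.symmetric]
    have hnr := cs.not_isReduced_alternatingWord j i (m := k + 1) h0' (by rw [M.symmetric]; omega)
    have h1 := cs.length_wordProd_le (CoxeterSystem.alternatingWord j i (k + 1))
    rw [CoxeterSystem.IsReduced] at hnr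
    rw [CoxeterSystem.length_alternatingWord] at h1 hnr
    have h2 : w * cs.simple i = v * cs.wordProd (CoxeterSystem.alternatingWord j i (k + 1)) := by
      rw [CoxeterSystem.alternatingWord_succ, cs.wordProd_concat, ← mul_assoc, ← hv]
    have h3 := cs.length_mul_le v (cs.wordProd (CoxeterSystem.alternatingWord j i (k + 1)))
    rw [← h2] at h3
    have h4 := cs.not_isRightDescent_iff.1 hw
    omega
  rw [hv, geom_mul, geom_alternating, map_add, map_smul, map_smul]
  simp only [Pi.add_apply, Pi.smul_apply, smul_eq_mul]
  have n1 := S_nonneg hij (k + 1) hkM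
  have n2 := S_nonneg hij k (hkM.imp id (fun h => by omega))
  have n3 := ih _ hlt v _ hy b rfl
  have n4 := ih _ hlt v _ hx b rfl
  exact add_nonneg (mul_nonneg n1 n3) (mul_nonneg n2 n4)

end Geom

end CoxOut
/-! ### Part 5: roots and the Tits cone -/

namespace CoxOut

section Tits

set_option linter.unusedSectionVars false

variable {B : Type} [Fintype B] [DecidableEq B] {M : CoxeterMatrix B}
variable {W : Type u} [Group W] (cs : CoxeterSystem M W)

/-- The roots. -/
def roots : Set (B → ℝ) := {α | ∃ (w : W) (i : B), α = geom cs w (sr i)}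

theorem sr_mem_roots (i : B) : sr i ∈ roots cs := ⟨1, i, by simp⟩

theorem geom_mem_roots (w : W) {α : B → ℝ} (h : α ∈ roots cs) : geom cs w α ∈ roots cs := by
  obtain ⟨w', i, rfl⟩ := h
  exact ⟨w * w', i, by rw [geom_mul]⟩

theorem geom_nonpos (w : W) (i : B) (hw : cs.IsRightDescent w i) : geom cs w (sr i) ≤ 0 := by
  intro b
  have h1 := cs.isRightDescent_iff_not_isRightDescent_mul.1 hw
  have h2 := geom_nonneg cs _ i h1 b
  rw [geom_mul, geom_simple_sr, map_neg] at h2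
  simpa using h2

theorem root_pos_or_neg {α : B → ℝ} (h : α ∈ roots cs) : 0 ≤ α ∨ α ≤ 0 := by
  obtain ⟨w, i, rfl⟩ := h
  by_cases hd : cs.IsRightDescent w i
  · exact Or.inr (geom_nonpos cs w i hd)
  · exact Or.inl (fun b => geom_nonneg cs w i hd b)

theorem sr_ne_zero (i : B) : sr i ≠ 0 := by
  intro h
  have := congrFun h i
  simp [sr] at this

theorem root_ne_zero {α : B → ℝ} (h : α ∈ roots cs) : α ≠ 0 := by
  obtain ⟨w, i, rfl⟩ := h
  intro h0
  exact sr_ne_zero i ((geom cs w).map_eq_zero_iff.1 h0)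

theorem not_pos_and_neg {α : B → ℝ} (h : α ∈ roots cs) (h1 : 0 ≤ α) (h2 : α ≤ 0) : False :=
  root_ne_zero cs h (le_antisymm h2 h1)

theorem eq_one_of_nonneg (w : W) (h : ∀ i, 0 ≤ geom cs w (sr i)) : w = 1 := by
  by_contra hw
  obtain ⟨i, hi⟩ := cs.exists_rightDescent_of_ne_one hw
  exact not_pos_and_neg cs (geom_mem_roots cs w (sr_mem_roots cs i)) (h i) (geom_nonpos cs w i hi)

theorem sr_nonneg (i : B) : (0 : B → ℝ) ≤ sr i := by
  intro b
  rw [sr, Pi.single_apply]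
  split_ifs <;> simp

theorem geom_injective : Function.Injective (geom cs) := by
  rw [injective_iff_map_eq_one]
  intro w hw
  apply eq_one_of_nonneg cs
  intro i
  rw [hw]
  exact sr_nonneg i

/-- The invariant quadratic form. -/
noncomputable def qf (M : CoxeterMatrix B) (v : B → ℝ) : ℝ := ∑ i, v i * coroot M i v

theorem qf_rf (k : B) (v : B → ℝ) : qf M (v - coroot M k v • sr k) = qf M v := by
  have h1 : ∑ i, v i * coroot M i (sr k) = coroot M k v := by
    rw [coroot_apply, ← Finset.sum_neg_distrib]
    refine Finset.sum_congr rfl (fun i _ => ?_)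
    rw [coroot_sr, cc_symm]
    ring
  have h2 : ∀ f : B → ℝ, ∑ i, sr k i * f i = f k := by
    intro f
    simp [sr, Pi.single_apply]
  set a := coroot M k v with ha
  have h3 : ∀ i, (v - a • sr k) i * coroot M i (v - a • sr k) = v i * coroot M i v
      - a * (v i * coroot M i (sr k)) - a * (sr k i * coroot M i v)
      + a * a * (sr k i * coroot M i (sr k)) := by
    intro i
    rw [map_sub, map_smul]
    simp only [Pi.sub_apply, Pi.smul_apply, smul_eq_mul]
    ring
  rw [qf, Finset.sum_congr rfl (fun i _ => h3 i), Finset.sum_add_distrib, Finset.sum_sub_distrib,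
    Finset.sum_sub_distrib, ← Finset.mul_sum, ← Finset.mul_sum, ← Finset.mul_sum, h1, h2, h2,
    coroot_sr_self, ← ha, qf]
  ring

theorem qf_geom (w : W) (v : B → ℝ) : qf M (geom cs w v) = qf M v := by
  induction w using cs.simple_induction_left with
  | one => simp
  | mul_simple_left w i ih => rw [geom_mul, geom_simple_apply, qf_rf, ih]

theorem qf_root {α : B → ℝ} (h : α ∈ roots cs) : qf M α = 2 := by
  obtain ⟨w, i, rfl⟩ := h
  rw [qf_geom, qf]
  have : ∀ j, sr i j * coroot M j (sr i) = if j = i then 2 else 0 := by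
    intro j
    by_cases hj : j = i
    · subst hj; rw [coroot_sr_self]; simp [sr]
    · simp [sr, hj]
  rw [Finset.sum_congr rfl (fun j _ => this j)]
  simp

theorem eq_sr_of_simple {α : B → ℝ} (h : α ∈ roots cs) (hα : 0 ≤ α) (i : B)
    (hi : ¬ 0 ≤ geom cs (cs.simple i) α) : α = sr i := by
  have hneg := (root_pos_or_neg cs (geom_mem_roots cs (cs.simple i) h)).resolve_left hi
  have h0 : ∀ j, j ≠ i → α j = 0 := by
    intro j hj
    have h1 := hneg j
    rw [geom_simple_apply] at h1
    simp only [Pi.sub_apply, Pi.smul_apply, sr, Pi.single_apply, hj, if_false, smul_zero,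
      sub_zero, Pi.zero_apply] at h1
    exact le_antisymm h1 (hα j)
  have h2 : α = α i • sr i := by
    ext j
    by_cases hj : j = i
    · subst hj; simp [sr]
    · simp [h0 j hj, sr, hj]
  have h3 : qf M (α i • sr i) = α i ^ 2 * qf M (sr i) := by
    simp only [qf, map_smul, Pi.smul_apply, smul_eq_mul, Finset.mul_sum]
    refine Finset.sum_congr rfl (fun j _ => by ring)
  rw [← h2, qf_root cs h, qf_root cs (sr_mem_roots cs i)] at h3
  have h4 : α i = 1 := by
    have h5 : 0 ≤ α i := hα i
    nlinarith
  rw [h2, h4, one_smul]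

/-- The dual action. -/
noncomputable def act (w : W) (y : Module.Dual ℝ (B → ℝ)) : Module.Dual ℝ (B → ℝ) :=
  y ∘ₗ (geom cs w⁻¹).toLinearMap

theorem act_apply (w : W) (y : Module.Dual ℝ (B → ℝ)) (v : B → ℝ) :
    act cs w y v = y (geom cs w⁻¹ v) := rfl

theorem act_mul (w w' : W) (y : Module.Dual ℝ (B → ℝ)) :
    act cs (w * w') y = act cs w (act cs w' y) := by
  refine LinearMap.ext (fun v => ?_)
  rw [act_apply, act_apply, act_apply, mul_inv_rev, geom_mul]

theorem act_one (y : Module.Dual ℝ (B → ℝ)) : act cs 1 y = y := by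
  refine LinearMap.ext (fun v => ?_)
  rw [act_apply]; simp

theorem act_combo (w : W) (a b : ℝ) (y z : Module.Dual ℝ (B → ℝ)) :
    act cs w (a • y + b • z) = a • act cs w y + b • act cs w z := by
  refine LinearMap.ext (fun v => ?_)
  rfl

theorem act_sum {ι : Type*} (w : W) (s : Finset ι) (f : ι → Module.Dual ℝ (B → ℝ)) :
    act cs w (∑ i ∈ s, f i) = ∑ i ∈ s, act cs w (f i) := by
  refine LinearMap.ext (fun v => ?_)
  simp [act_apply, LinearMap.sum_apply]

theorem act_simple (i : B) (y : Module.Dual ℝ (B → ℝ)) (v : B → ℝ) :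
    act cs (cs.simple i) y v = y v - coroot M i v * y (sr i) := by
  rw [act_apply, cs.inv_simple, geom_simple_apply, map_sub, map_smul, smul_eq_mul]

theorem act_simple_eq_iff (i : B) (y : Module.Dual ℝ (B → ℝ)) :
    act cs (cs.simple i) y = y ↔ y (sr i) = 0 := by
  constructor
  · intro h
    have h1 := congrArg (fun f : Module.Dual ℝ (B → ℝ) => f (sr i)) h
    simp only [act_simple, coroot_sr_self] at h1
    linarith
  · intro h
    refine LinearMap.ext (fun v => ?_)
    rw [act_simple, h, mul_zero, sub_zero]

/-- The stabilizer of a point. -/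
noncomputable def stab (y : Module.Dual ℝ (B → ℝ)) : Subgroup W where
  carrier := {w | act cs w y = y}
  one_mem' := act_one cs y
  mul_mem' := by
    intro a b ha hb
    change act cs (a * b) y = y
    rw [act_mul, hb, ha]
  inv_mem' := by
    intro a ha
    change act cs a⁻¹ y = y
    have ha' : act cs a y = y := ha
    calc act cs a⁻¹ y = act cs a⁻¹ (act cs a y) := by rw [ha']
      _ = y := by rw [← act_mul, inv_mul_cancel, act_one]

theorem mem_stab {y : Module.Dual ℝ (B → ℝ)} {w : W} : w ∈ stab cs y ↔ act cs w y = y := Iff.rfl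

theorem mem_stab_act {y : Module.Dual ℝ (B → ℝ)} {g w : W} :
    w ∈ stab cs (act cs g y) ↔ g⁻¹ * w * g ∈ stab cs y := by
  rw [mem_stab, mem_stab, act_mul, act_mul]
  constructor
  · intro h
    rw [h, ← act_mul, inv_mul_cancel, act_one]
  · intro h
    have := congrArg (act cs g) h
    rwa [← act_mul, mul_inv_cancel, act_one] at this

/-- The positive roots which are not positive on `y`. -/
def nr (y : Module.Dual ℝ (B → ℝ)) : Set (B → ℝ) := {α | α ∈ roots cs ∧ 0 ≤ α ∧ y α ≤ 0}

theorem nr_act_simple (i : B) (y : Module.Dual ℝ (B → ℝ)) (h : (nr cs y).Finite) :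
    (nr cs (act cs (cs.simple i) y)).Finite := by
  refine ((h.image (geom cs (cs.simple i))).union (Set.finite_singleton (sr i))).subset ?_
  rintro α ⟨h1, h2, h3⟩
  by_cases hi : 0 ≤ geom cs (cs.simple i) α
  · left
    refine ⟨geom cs (cs.simple i) α, ⟨geom_mem_roots cs _ h1, hi, ?_⟩, ?_⟩
    · rwa [act_apply, cs.inv_simple] at h3
    · rw [← geom_mul, cs.simple_mul_simple_self]; simp
  · right
    exact eq_sr_of_simple cs h1 h2 i hi

theorem nr_act (w : W) (y : Module.Dual ℝ (B → ℝ)) (h : (nr cs y).Finite) :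
    (nr cs (act cs w y)).Finite := by
  induction w using cs.simple_induction_left with
  | one => rwa [act_one]
  | mul_simple_left w i ih => rw [act_mul]; exact nr_act_simple cs i _ ih

theorem nr_combo (a b : ℝ) (ha : 0 ≤ a) (hb : 0 ≤ b) (hab : 0 < a + b)
    (y z : Module.Dual ℝ (B → ℝ)) (hy : (nr cs y).Finite) (hz : (nr cs z).Finite) :
    (nr cs (a • y + b • z)).Finite := by
  refine (hy.union hz).subset ?_
  rintro α ⟨h1, h2, h3⟩
  by_contra hcon
  have hy' : 0 < y α := by
    by_contra h
    exact hcon (Or.inl ⟨h1, h2, not_lt.1 h⟩)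
  have hz' : 0 < z α := by
    by_contra h
    exact hcon (Or.inr ⟨h1, h2, not_lt.1 h⟩)
  simp only [LinearMap.add_apply, LinearMap.smul_apply, smul_eq_mul] at h3
  rcases ha.lt_or_eq with h | h
  · have := mul_pos h hy'
    have := mul_nonneg hb hz'.le
    linarith
  · subst h
    have := mul_pos (by linarith : 0 < b) hz'
    linarith

theorem nr_sum {ι : Type*} (s : Finset ι) (hs : s.Nonempty) (f : ι → Module.Dual ℝ (B → ℝ))
    (h : ∀ i ∈ s, (nr cs (f i)).Finite) : (nr cs (∑ i ∈ s, f i)).Finite := by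
  refine (Set.Finite.biUnion s.finite_toSet h).subset ?_
  rintro α ⟨h1, h2, h3⟩
  by_contra hcon
  have hpos : ∀ i ∈ s, 0 < f i α := by
    intro i hi
    by_contra h
    apply hcon
    simp only [Set.mem_iUnion]
    exact ⟨i, hi, h1, h2, not_lt.1 h⟩
  have := Finset.sum_pos hpos hs
  rw [LinearMap.sum_apply] at h3
  linarith

/-- The closed fundamental chamber. -/
def dom : Set (Module.Dual ℝ (B → ℝ)) := {y | ∀ i, 0 ≤ y (sr i)}

theorem apply_eq_sum (y : Module.Dual ℝ (B → ℝ)) (v : B → ℝ) : y v = ∑ i, v i * y (sr i) := by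
  conv_lhs => rw [pi_eq_sum_univ' v]
  rw [map_sum]
  refine Finset.sum_congr rfl (fun i _ => ?_)
  rw [map_smul, smul_eq_mul]
  congr 2

theorem dom_nonneg {y : Module.Dual ℝ (B → ℝ)} (hy : y ∈ dom) {v : B → ℝ} (hv : 0 ≤ v) :
    0 ≤ y v := by
  rw [apply_eq_sum]
  exact Finset.sum_nonneg (fun i _ => mul_nonneg (hv i) (hy i))

theorem exists_act_mem_dom (y : Module.Dual ℝ (B → ℝ)) (h : (nr cs y).Finite) :
    ∃ w, act cs w y ∈ dom := by
  induction hn : (nr cs y).ncard using Nat.strong_induction_on generalizing y with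
  | _ n ih =>
  subst hn
  by_cases hd : y ∈ dom
  · exact ⟨1, by rwa [act_one]⟩
  simp only [dom, Set.mem_ofPred_eq, not_forall, not_le] at hd
  obtain ⟨i, hi⟩ := hd
  have hsub : nr cs (act cs (cs.simple i) y) ⊆ geom cs (cs.simple i) '' (nr cs y \ {sr i}) := by
    rintro α ⟨h1, h2, h3⟩
    rw [act_apply, cs.inv_simple] at h3
    have hback : geom cs (cs.simple i) (geom cs (cs.simple i) α) = α := by
      rw [← geom_mul, cs.simple_mul_simple_self]; simp
    by_cases hp : 0 ≤ geom cs (cs.simple i) α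
    · refine ⟨geom cs (cs.simple i) α, ⟨⟨geom_mem_roots cs _ h1, hp, h3⟩, ?_⟩, hback⟩
      intro heq
      rw [Set.mem_singleton_iff] at heq
      rw [heq, geom_simple_sr] at hback
      refine not_pos_and_neg cs h1 h2 ?_
      rw [← hback]
      exact neg_nonpos.2 (sr_nonneg i)
    · have := eq_sr_of_simple cs h1 h2 i hp
      subst this
      rw [geom_simple_sr, map_neg] at h3
      linarith
  have hlt : (nr cs (act cs (cs.simple i) y)).ncard < (nr cs y).ncard := by
    calc _ ≤ (geom cs (cs.simple i) '' (nr cs y \ {sr i})).ncard :=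
          Set.ncard_le_ncard hsub ((h.subset Set.sdiff_subset).image _)
      _ ≤ (nr cs y \ {sr i}).ncard := Set.ncard_image_le (h.subset Set.sdiff_subset)
      _ < (nr cs y).ncard := Set.ncard_sdiff_singleton_lt_of_mem
          ⟨sr_mem_roots cs i, sr_nonneg i, hi.le⟩ h
  obtain ⟨w, hw⟩ := ih _ hlt _ (nr_act_simple cs i y h) rfl
  exact ⟨w * cs.simple i, by rwa [act_mul]⟩

/-- The standard parabolic subgroup. -/
def par (T : Set B) : Subgroup W := Subgroup.closure (cs.simple '' T)

theorem dom_unique (w : W) (y : Module.Dual ℝ (B → ℝ)) (hy : y ∈ dom) (hwy : act cs w y ∈ dom) :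
    act cs w y = y ∧ w ∈ par cs {i | y (sr i) = 0} := by
  induction hn : cs.length w using Nat.strong_induction_on generalizing w with
  | _ n ih =>
  subst hn
  by_cases hw : w = 1
  · subst hw
    exact ⟨act_one cs y, Subgroup.one_mem _⟩
  obtain ⟨i, hi⟩ := cs.exists_rightDescent_of_ne_one hw
  have h1 := geom_nonpos cs w i hi
  have h2 : act cs w y (geom cs w (sr i)) = y (sr i) := by
    rw [act_apply, ← geom_mul, inv_mul_cancel]; simp
  have h3 : y (sr i) = 0 := by
    refine le_antisymm ?_ (hy i)
    have := dom_nonneg hwy (neg_nonneg.2 h1)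
    rw [map_neg, h2] at this
    linarith
  have h4 : act cs (w * cs.simple i) y = act cs w y := by
    rw [act_mul, (act_simple_eq_iff cs i y).2 h3]
  obtain ⟨h5, h6⟩ := ih _ hi (w * cs.simple i) (by rwa [h4]) rfl
  rw [h4] at h5
  refine ⟨h5, ?_⟩
  have h7 : cs.simple i ∈ par cs {i | y (sr i) = 0} := Subgroup.subset_closure ⟨i, h3, rfl⟩
  have := Subgroup.mul_mem _ h6 h7
  rwa [cs.simple_mul_simple_cancel_right] at this

theorem stab_eq_par (y : Module.Dual ℝ (B → ℝ)) (hy : y ∈ dom) :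
    stab cs y = par cs {i | y (sr i) = 0} := by
  apply le_antisymm
  · intro w hw
    exact (dom_unique cs w y hy (by rw [(mem_stab cs).1 hw]; exact hy)).2
  · rw [par, Subgroup.closure_le]
    rintro _ ⟨i, hi, rfl⟩
    exact (act_simple_eq_iff cs i y).2 hi

theorem stab_finite_of_dom (y : Module.Dual ℝ (B → ℝ)) (hy : y ∈ dom) (h : (nr cs y).Finite) :
    (stab cs y : Set W).Finite := by
  refine Set.Finite.of_injOn (f := fun w => {α | α ∈ roots cs ∧ 0 ≤ α ∧ geom cs w α ≤ 0})
    (t := {s | s ⊆ nr cs y}) ?_ ?_ h.finite_subsets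
  · rintro w hw α ⟨h1, h2, h3⟩
    refine ⟨h1, h2, ?_⟩
    have h4 : act cs w y = y := hw
    have h5 : y α = y (geom cs w α) := by
      conv_rhs => rw [← h4, act_apply, ← geom_mul, inv_mul_cancel]
      simp
    rw [h5]
    have := dom_nonneg hy (neg_nonneg.2 h3)
    rw [map_neg] at this
    linarith
  · intro w hw w' hw' heq
    simp only at heq
    have : w' * w⁻¹ = 1 := by
      apply eq_one_of_nonneg cs
      intro i
      have hr := geom_mem_roots cs w⁻¹ (sr_mem_roots cs i)
      have hb : geom cs w (geom cs w⁻¹ (sr i)) = sr i := by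
        rw [← geom_mul, mul_inv_cancel]; simp
      rw [geom_mul]
      rcases root_pos_or_neg cs hr with hp | hp
      · refine (root_pos_or_neg cs (geom_mem_roots cs w' hr)).resolve_right ?_
        intro hn
        have hmem : geom cs w⁻¹ (sr i) ∈ {α | α ∈ roots cs ∧ 0 ≤ α ∧ geom cs w α ≤ 0} := by
          rw [heq]; exact ⟨hr, hp, hn⟩
        have := hmem.2.2
        rw [hb] at this
        exact not_pos_and_neg cs (sr_mem_roots cs i) (sr_nonneg i) this
      · have hr' : -geom cs w⁻¹ (sr i) ∈ roots cs := by
          refine ⟨w⁻¹ * cs.simple i, i, ?_⟩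
          rw [geom_mul, geom_simple_sr, map_neg]
        have hmem : -geom cs w⁻¹ (sr i) ∈ {α | α ∈ roots cs ∧ 0 ≤ α ∧ geom cs w' α ≤ 0} := by
          rw [← heq]
          refine ⟨hr', neg_nonneg.2 hp, ?_⟩
          rw [map_neg, hb]
          exact neg_nonpos.2 (sr_nonneg i)
        have := hmem.2.2
        rw [map_neg] at this
        exact neg_nonpos.1 this
    exact (mul_inv_eq_one.1 this).symm

theorem stab_finite (y : Module.Dual ℝ (B → ℝ)) (h : (nr cs y).Finite) :
    (stab cs y : Set W).Finite := by
  obtain ⟨w, hw⟩ := exists_act_mem_dom cs y h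
  have h1 := stab_finite_of_dom cs _ hw (nr_act cs w y h)
  refine (h1.image (fun x => w⁻¹ * x * w)).subset ?_
  intro x hx
  refine ⟨w * x * w⁻¹, ?_, by group⟩
  refine (mem_stab_act cs).2 ?_
  have : w⁻¹ * (w * x * w⁻¹) * w = x := by group
  rw [this]
  exact hx

/-- Every finite subgroup fixes a point in the interior of the Tits cone. -/
theorem exists_fixed (F : Subgroup W) [Finite F] :
    ∃ y : Module.Dual ℝ (B → ℝ), (nr cs y).Finite ∧ F ≤ stab cs y := by
  have : Fintype F := Fintype.ofFinite F
  let x : Module.Dual ℝ (B → ℝ) := ∑ i, (LinearMap.proj i : (B → ℝ) →ₗ[ℝ] ℝ)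
  have hx : nr cs x = ∅ := by
    rw [Set.eq_empty_iff_forall_notMem]
    rintro α ⟨h1, h2, h3⟩
    apply root_ne_zero cs h1
    have h4 : x α = ∑ i, α i := by simp [x]
    have h5 : ∑ i, α i = 0 := le_antisymm (h4 ▸ h3) (Finset.sum_nonneg (fun i _ => h2 i))
    rw [Finset.sum_eq_zero_iff_of_nonneg (fun i _ => h2 i)] at h5
    ext i
    exact h5 i (Finset.mem_univ i)
  refine ⟨∑ f : F, act cs f x, ?_, ?_⟩
  · refine nr_sum cs _ ⟨1, Finset.mem_univ _⟩ _ (fun f _ => nr_act cs _ _ ?_)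
    rw [hx]
    exact Set.finite_empty
  · intro g hg
    rw [mem_stab, act_sum]
    refine Fintype.sum_equiv (Equiv.mulLeft (⟨g, hg⟩ : F)) _ _ (fun f => ?_)
    rw [← act_mul]
    rfl

theorem exists_conj_par (F : Subgroup W) [Finite F] :
    ∃ (w : W) (T : Set B), (par cs T : Set W).Finite ∧ ∀ f ∈ F, w * f * w⁻¹ ∈ par cs T := by
  obtain ⟨y, hy, hF⟩ := exists_fixed cs F
  obtain ⟨w, hw⟩ := exists_act_mem_dom cs y hy
  refine ⟨w, {i | act cs w y (sr i) = 0}, ?_, ?_⟩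
  · rw [← stab_eq_par cs _ hw]
    exact stab_finite cs _ (nr_act cs w y hy)
  · intro f hf
    rw [← stab_eq_par cs _ hw, mem_stab_act]
    have : w⁻¹ * (w * f * w⁻¹) * w = f := by group
    rw [this]
    exact hF hf

theorem centralizer_le (cs : CoxeterSystem M W) (H : Subgroup W) [Finite H]
    (hmax : ∀ F : Subgroup W, Finite F → Nat.card F ≤ Nat.card H) :
    Subgroup.centralizer (H : Set W) ≤ H := by
  have hst : ∀ y, (nr cs y).Finite → H ≤ stab cs y → stab cs y = H := by
    intro y hy hle
    have : Finite (stab cs y) := stab_finite cs y hy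
    exact (Subgroup.eq_of_le_of_card_ge hle (hmax _ this)).symm
  obtain ⟨y0, hy0, hH⟩ := exists_fixed cs H
  intro n hn
  have hHn : H ≤ stab cs (act cs n y0) := by
    intro h hh
    rw [mem_stab_act]
    have : n⁻¹ * h * n = h := by
      have := hn h hh
      rw [mul_assoc, this, inv_mul_cancel_left]
    rw [this]
    exact hH hh
  have hny := nr_act cs n y0 hy0
  obtain ⟨w, hw⟩ := exists_act_mem_dom cs y0 hy0
  have hdom : act cs w (act cs n y0) ∈ dom := by
    intro i
    by_contra hcon
    rw [not_le] at hcon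
    set p := act cs w y0 (sr i) with hp
    set q := act cs w (act cs n y0) (sr i) with hq
    have hp0 : 0 ≤ p := hw i
    -- a point of the segment on the wall
    have hz := nr_combo cs (-q) p (by linarith) hp0 (by linarith) y0 (act cs n y0) hy0 hny
    set z := (-q) • y0 + p • act cs n y0 with hzdef
    have hHz : H ≤ stab cs z := by
      intro h hh
      rw [mem_stab, hzdef, act_combo, (mem_stab cs).1 (hH hh), (mem_stab cs).1 (hHn hh)]
    have hzi : act cs w z (sr i) = 0 := by
      rw [hzdef, act_combo]
      simp only [LinearMap.add_apply, LinearMap.smul_apply, smul_eq_mul, ← hp, ← hq]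
      ring
    have h1 : cs.simple i ∈ stab cs (act cs w z) := (act_simple_eq_iff cs i _).2 hzi
    rw [mem_stab_act, hst z hz hHz] at h1
    have h2 : cs.simple i ∈ stab cs (act cs w (act cs n y0)) := (mem_stab_act cs).2 (hHn h1)
    have h3 := (act_simple_eq_iff cs i _).1 h2
    rw [← hq] at h3
    linarith
  have h5 : act cs (w * n * w⁻¹) (act cs w y0) = act cs w (act cs n y0) := by
    rw [← act_mul, ← act_mul]; congr 1; group
  have h6 := (dom_unique cs (w * n * w⁻¹) _ hw (by rwa [h5])).1
  have h7 : w * n * w⁻¹ ∈ stab cs (act cs w y0) := h6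
  rw [mem_stab_act] at h7
  have : w⁻¹ * (w * n * w⁻¹) * w = n := by group
  rwa [this, hst y0 hy0 hH] at h7

end Tits

end CoxOut
/-! ### Part 6: conclusion -/

namespace CoxOut

section Final

set_option linter.unusedSectionVars false

variable {B : Type} [Fintype B] [DecidableEq B] {M : CoxeterMatrix B}
variable {W : Type u} [Group W] (cs : CoxeterSystem M W)

/-- The ring generated by the numbers `2 cos (π / m)`. -/
noncomputable def ringA (M : CoxeterMatrix B) : Subalgebra ℤ ℝ :=
  Algebra.adjoin ℤ (Set.range (fun x : B × B => cc M x.1 x.2))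

theorem cc_mem (i j : B) : cc M i j ∈ ringA M := Algebra.subset_adjoin ⟨(i, j), rfl⟩

theorem ringA_fg : (Subalgebra.toSubmodule (ringA M)).FG := by
  apply fg_adjoin_of_finite (Set.finite_range _)
  rintro _ ⟨⟨i, j⟩, rfl⟩
  have := Real.isIntegral_two_mul_cos_rat_mul_pi (1 / (M i j : ℚ))
  have e : cc M i j = 2 * Real.cos (((1 / (M i j : ℚ) : ℚ) : ℝ) * Real.pi) := by
    rw [cc]
    congr 2
    push_cast
    ring
  change IsIntegral ℤ (cc M i j)
  rw [e]
  exact this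

/-- The invariant lattice. -/
noncomputable def lat (M : CoxeterMatrix B) : Submodule ℤ (B → ℝ) :=
  Submodule.pi Set.univ (fun _ => Subalgebra.toSubmodule (ringA M))

theorem mem_lat {v : B → ℝ} : v ∈ lat M ↔ ∀ i, v i ∈ ringA M := by
  simp [lat, Submodule.mem_pi]

instance : Module.Finite ℤ (lat M) :=
  Module.Finite.iff_fg.2 (Submodule.fg_pi (fun _ => ringA_fg))

theorem sr_mem_lat (i : B) : sr i ∈ lat M := by
  rw [mem_lat]
  intro j
  rw [sr, Pi.single_apply]
  split_ifs
  · exact one_mem _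
  · exact zero_mem _

theorem geom_mem_lat (w : W) (v : B → ℝ) (hv : v ∈ lat M) : geom cs w v ∈ lat M := by
  induction w using cs.simple_induction_left with
  | one => simpa using hv
  | mul_simple_left w i ih =>
    rw [geom_mul, geom_simple_apply]
    generalize geom cs w v = u at ih
    have h1 : coroot M i u ∈ ringA M := by
      rw [coroot_apply]
      refine neg_mem (sum_mem (fun j _ => ?_))
      exact mul_mem (cc_mem _ _) (mem_lat.1 ih _)
    rw [mem_lat]
    intro j
    exact sub_mem (mem_lat.1 ih j) (mul_mem h1 (mem_lat.1 (sr_mem_lat i) j))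

/-- The integral representation. -/
noncomputable def latRep : W →* Module.End ℤ (lat M) where
  toFun w := ((geom cs w).toLinearMap.restrictScalars ℤ).restrict (geom_mem_lat cs w)
  map_one' := by
    refine LinearMap.ext (fun v => Subtype.ext ?_)
    simp [LinearMap.restrict_apply]
  map_mul' a b := by
    refine LinearMap.ext (fun v => Subtype.ext ?_)
    change geom cs (a * b) (v : B → ℝ) = geom cs a (geom cs b (v : B → ℝ))
    rw [geom_mul]

theorem latRep_apply (w : W) (v : lat M) : (latRep cs w v : B → ℝ) = geom cs w v := rfl

theorem latRep_injective : Function.Injective (latRep cs) := by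
  rw [injective_iff_map_eq_one]
  intro w hw
  apply eq_one_of_nonneg cs
  intro i
  have := latRep_apply cs w ⟨sr i, sr_mem_lat i⟩
  rw [hw] at this
  rw [← this]
  exact sr_nonneg i

theorem virtuallyResiduallyP_coxeter (cs : CoxeterSystem M W) {p : ℕ} [Fact p.Prime] :
    VirtuallyResiduallyP p W :=
  virtuallyResiduallyP_of_lattice W (lat M) (latRep cs) (latRep_injective cs)

theorem fg_coxeter (cs : CoxeterSystem M W) : Group.FG W := by
  rw [Group.fg_iff]
  exact ⟨_, cs.subgroup_closure_range_simple, Set.finite_range _⟩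

theorem card_le_par (F : Subgroup W) [Finite F] :
    ∃ T : Set B, (par cs T : Set W).Finite ∧ Nat.card F ≤ Nat.card (par cs T) := by
  obtain ⟨w, T, hT, h⟩ := exists_conj_par cs F
  refine ⟨T, hT, ?_⟩
  have : Finite (par cs T) := hT
  refine Nat.card_le_card_of_injective (fun f : F => (⟨w * f * w⁻¹, h f f.2⟩ : par cs T)) ?_
  intro a b hab
  have := congrArg Subtype.val hab
  simpa using this

theorem out_coxeter (cs : CoxeterSystem M W) {p : ℕ} [Fact p.Prime] :
    VirtuallyResiduallyP p (Out W) := by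
  have := fg_coxeter cs
  have hAut := virtuallyResiduallyP_mulAut (p := p) W (virtuallyResiduallyP_coxeter cs)
  let 𝒯 : Set (Set B) := {T | (par cs T : Set W).Finite}
  have hne : 𝒯.Nonempty := by
    obtain ⟨T, hT, -⟩ := card_le_par cs (⊥ : Subgroup W)
    exact ⟨T, hT⟩
  obtain ⟨T0, hT0, hmax⟩ := Set.exists_max_image 𝒯 (fun T => Nat.card (par cs T))
    (Set.toFinite 𝒯) hne
  have hfin : Finite (par cs T0) := hT0
  have hmax' : ∀ F : Subgroup W, Finite F → Nat.card F ≤ Nat.card (par cs T0) := by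
    intro F hF
    obtain ⟨T, hT, hle⟩ := card_le_par cs F
    exact hle.trans (hmax T hT)
  have hU : (⋃ T ∈ 𝒯, (par cs T : Set W)).Finite :=
    Set.Finite.biUnion (Set.toFinite 𝒯) (fun T hT => hT)
  refine virtuallyResiduallyP_out W (par cs T0)
    (Set.Finite.subset hT0 (centralizer_le cs (par cs T0) hmax'))
    (Set.pi Set.univ (fun _ => ⋃ T ∈ 𝒯, (par cs T : Set W))) (Set.Finite.pi (fun _ => hU)) ?_ hAut
  intro φ
  have : Finite ((par cs T0).map φ.toMonoidHom) :=
    Set.Finite.subset (hT0.image φ) (by rintro _ ⟨x, hx, rfl⟩; exact ⟨x, hx, rfl⟩)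
  obtain ⟨w, T, hT, h⟩ := exists_conj_par cs ((par cs T0).map φ.toMonoidHom)
  refine ⟨fun x => w * φ x * w⁻¹, ?_, w⁻¹, fun x => by group⟩
  intro x _
  exact Set.mem_biUnion (show T ∈ 𝒯 from hT) (h _ ⟨x, x.2, rfl⟩)

end Final

end CoxOut

/-- If `G` is a finitely generated Coxeter group, then `Out(G)` is virtually
residually `p` for all but finitely many primes `p`. -/
theorem statement3 (G : Type*) [Group G]
    (hcox : ∃ (B : Type) (_ : Finite B) (M : CoxeterMatrix B), Nonempty (CoxeterSystem M G)) :
    {p : ℕ | p.Prime ∧ ¬ VirtuallyResiduallyP p (Out G)}.Finite := by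
  classical
  obtain ⟨B, hB, M, ⟨cs⟩⟩ := hcox
  have : Fintype B := Fintype.ofFinite B
  refine Set.finite_empty.subset ?_
  rintro p ⟨hp, hn⟩
  have : Fact p.Prime := ⟨hp⟩
  exact hn (CoxOut.out_coxeter cs)
end
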